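/- arXiv:1004.1376 — 2 statements merged into one kernel-verified Lean document; each statement's English description precedes it below -/
import Mathlib

section
/- Let A be a unital ℂ-algebra equipped with an action of H by ℂ-algebra automorphisms such that the subgroup G acts trivially (so Q acts on A via h·a for any h with j(h) = q, independently of the choice). Let A⋊H be the crossed product algebra: the vector space A ⊗ ℂH with product (a₁⊗h₁)·(a₂⊗h₂) := a₁·h₁(a₂) ⊗ h₁h₂. Let Ã⋊_c Q be the twisted crossed product algebra: the vector space of functions f : Ĝ → A tensored with ℂQ, with product (f₁⊗q₁)·(f₂⊗q₂) := ([ρ] ↦ c^{[ρ]}(q₁,q₂)·f₁([ρ])·q₁(f₂(q₁([ρ])))) ⊗ q₁q₂. Then A⋊H is Morita equivalent to Ã⋊_c Q. -/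
noncomputable section

/-- A representation is irreducible if the space is nonzero and has no nontrivial invariant
subspace. -/
def IsIrredRep {K V : Type} [Group K] [AddCommGroup V] [Module ℂ V]
    (ρ : Representation ℂ K V) : Prop :=
  Nontrivial V ∧
    ∀ W : Submodule ℂ V, (∀ (k : K), ∀ v ∈ W, ρ k v ∈ W) → W = ⊥ ∨ W = ⊤

/-- Two representations are isomorphic if there is an intertwining linear equivalence. -/
def RepIso {K V W : Type} [Group K] [AddCommGroup V] [Module ℂ V]
    [AddCommGroup W] [Module ℂ W]
    (ρ : Representation ℂ K V) (σ : Representation ℂ K W) : Prop :=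
  ∃ e : V ≃ₗ[ℂ] W, ∀ (k : K) (v : V), e (ρ k v) = σ k (e v)

/-- The representation `g ↦ ρ (h·g·h⁻¹)` of the (normal) kernel of `j`, for `h : H`. -/
def conjRep {H Q : Type} [Group H] [Group Q] (j : H →* Q) {V : Type}
    [AddCommGroup V] [Module ℂ V] (ρ : Representation ℂ j.ker V) (h : H) :
    Representation ℂ j.ker V :=
  MonoidHom.comp ρ (MulAut.conjNormal h).toMonoidHom

/-- `τ(q₁,q₂) := s q₁ * s q₂ * (s (q₁ q₂))⁻¹`, an element of `G = ker j`. -/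
def tau {H Q : Type} [Group H] [Group Q] (j : H →* Q) (s : Q → H)
    (hs : ∀ q, j (s q) = q) (q₁ q₂ : Q) : j.ker :=
  ⟨s q₁ * s q₂ * (s (q₁ * q₂))⁻¹, by simp [MonoidHom.mem_ker, hs, mul_assoc]⟩

/-- Transport along an equality of indices, as a linear map. -/
def castHom {Ghat : Type} (V : Ghat → Type) [∀ r, AddCommGroup (V r)]
    [∀ r, Module ℂ (V r)] {a b : Ghat} (h : a = b) : V a →ₗ[ℂ] V b where
  toFun v := cast (congrArg V h) v
  map_add' := by subst h; intros; rfl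
  map_smul' := by subst h; intros; rfl

/-- Two ℂ-algebras are Morita equivalent if their categories of left modules are
ℂ-linearly equivalent. -/
def MoritaEquiv (A B : Type) [Ring A] [Ring B] [Algebra ℂ A] [Algebra ℂ B] : Prop :=
  ∃ e : ModuleCat.{0} A ≌ ModuleCat.{0} B, ∃ _h : e.functor.Additive, e.functor.Linear ℂ

/-- The underlying ℂ-vector space `A ⊗ ℂH` of the crossed product `A⋊H`, encoded as
`A`-valued functions on `H`. -/
structure CrossH (H A : Type) where
  /-- the coefficient at the basis vector `h ∈ H` -/
  coef : H → A

/-- The underlying ℂ-vector space of the twisted crossed product `Ã⋊_c Q`: functions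
`Ĝ → A` tensored with `ℂQ`, encoded as functions `Q → Ĝ → A`. -/
structure CrossQ (Ghat Q A : Type) where
  /-- the coefficient at the basis vector `q ∈ Q`, a function `Ĝ → A` -/
  coef : Q → Ghat → A

section GroupAlgebra

open scoped MonoidAlgebra

variable {K V W : Type} [Group K] [AddCommGroup V] [Module ℂ V] [AddCommGroup W] [Module ℂ W]
  {ρ : Representation ℂ K V} {σ : Representation ℂ K W}

theorem IsIrredRep.eq_zero_or_repIso (hρ : IsIrredRep ρ) (hσ : IsIrredRep σ) (f : V →ₗ[ℂ] W)
    (hf : ∀ k v, f (ρ k v) = σ k (f v)) : f = 0 ∨ RepIso ρ σ := by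
  rcases hρ.2 (LinearMap.ker f) fun k v hv => by
    rw [LinearMap.mem_ker, hf, LinearMap.mem_ker.1 hv, map_zero] with hk | hk
  · rcases hσ.2 (LinearMap.range f) (by
      rintro k _ ⟨v, rfl⟩
      exact ⟨ρ k v, hf k v⟩) with hr | hr
    · exact .inl (LinearMap.range_eq_bot.1 hr)
    · exact .inr ⟨LinearEquiv.ofBijective f
        ⟨LinearMap.ker_eq_bot.1 hk, LinearMap.range_eq_top.1 hr⟩, hf⟩
  · exact .inl (LinearMap.ker_eq_top.1 hk)

theorem IsIrredRep.exists_eq_smul_id [FiniteDimensional ℂ V] (hρ : IsIrredRep ρ)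
    (f : V →ₗ[ℂ] V) (hf : ∀ k v, f (ρ k v) = ρ k (f v)) : ∃ a : ℂ, f = a • LinearMap.id := by
  have := hρ.1
  obtain ⟨a, ha⟩ := Module.End.exists_eigenvalue f
  refine ⟨a, ?_⟩
  rcases hρ.2 (Module.End.eigenspace f a) fun k v hv => by
    rw [Module.End.mem_eigenspace_iff] at hv ⊢
    rw [hf, hv, map_smul] with h | h
  · exact (ha h).elim
  · ext v
    exact Module.End.mem_eigenspace_iff.1 (h ▸ Submodule.mem_top : v ∈ Module.End.eigenspace f a)

theorem repIso_asAlgebraHom {e : V ≃ₗ[ℂ] W} (he : ∀ k v, e (ρ k v) = σ k (e v))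
    (x : MonoidAlgebra ℂ K) (v : V) : e (ρ.asAlgebraHom x v) = σ.asAlgebraHom x (e v) := by
  induction x using MonoidAlgebra.induction_on with
  | of k => simpa using he k v
  | add x y hx hy => simp only [map_add, LinearMap.add_apply, hx, hy]
  | smul r x hx => simp only [map_smul, LinearMap.smul_apply, hx]

variable [Fintype K]

theorem sum_conj_intertwines (X : V →ₗ[ℂ] W) (k : K) (v : V) :
    (∑ g, σ g ∘ₗ X ∘ₗ ρ g⁻¹) (ρ k v) = σ k ((∑ g, σ g ∘ₗ X ∘ₗ ρ g⁻¹) v) := by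
  simp only [LinearMap.sum_apply, LinearMap.comp_apply, map_sum]
  refine Fintype.sum_equiv (Equiv.mulLeft k⁻¹) _ _ fun g => ?_
  simp only [Equiv.coe_mulLeft, ← Module.End.mul_apply, ← map_mul]
  simp [Module.End.mul_apply]

theorem IsIrredRep.sum_conj_eq_zero (hρ : IsIrredRep ρ) (hσ : IsIrredRep σ) (h : ¬ RepIso ρ σ)
    (X : V →ₗ[ℂ] W) : ∑ g, σ g ∘ₗ X ∘ₗ ρ g⁻¹ = 0 :=
  (hρ.eq_zero_or_repIso hσ _ (sum_conj_intertwines X)).resolve_right h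

/-- The normalising scalar `dim V / |K|` of the matrix units of a representation on `V`. -/
def unitScalar (K V : Type) [Fintype K] [AddCommGroup V] [Module ℂ V] : ℂ :=
  Module.finrank ℂ V / Fintype.card K

theorem IsIrredRep.smul_sum_conj [FiniteDimensional ℂ V] (hρ : IsIrredRep ρ) (X : V →ₗ[ℂ] V) :
    unitScalar K V • ∑ g, ρ g ∘ₗ X ∘ₗ ρ g⁻¹ = LinearMap.trace ℂ V X • LinearMap.id := by
  have := hρ.1
  have h1 : (Module.finrank ℂ V : ℂ) ≠ 0 := by
    exact_mod_cast (Module.finrank_pos (R := ℂ) (M := V)).ne'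
  have h2 : (Fintype.card K : ℂ) ≠ 0 := by exact_mod_cast Fintype.card_ne_zero
  obtain ⟨a, ha⟩ := hρ.exists_eq_smul_id _ (sum_conj_intertwines (ρ := ρ) (σ := ρ) X)
  have htr : LinearMap.trace ℂ V (∑ g, ρ g ∘ₗ X ∘ₗ ρ g⁻¹) =
      Fintype.card K * LinearMap.trace ℂ V X := by
    rw [map_sum, Finset.sum_congr rfl fun g _ => ?_, Finset.sum_const, nsmul_eq_mul,
      Finset.card_univ]
    rw [LinearMap.trace_comp_comm', LinearMap.comp_assoc, ← Module.End.mul_eq_comp (ρ g⁻¹),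
      ← map_mul, inv_mul_cancel, map_one]
    rfl
  rw [ha, map_smul, LinearMap.trace_id, smul_eq_mul] at htr
  rw [ha, smul_smul]
  congr 1
  rw [unitScalar, div_mul_eq_mul_div, mul_comm, htr, mul_div_cancel_left₀ _ h2]

/-- The element of the group algebra of `K` that acts on an irreducible representation `ρ` as the
rank one operator `w ↦ ξ w • v`, and as zero on the other irreducible representations. -/
def matrixUnit (ρ : Representation ℂ K V) (ξ : V →ₗ[ℂ] ℂ) : V →ₗ[ℂ] MonoidAlgebra ℂ K where
  toFun v := ∑ g, (unitScalar K V * ξ (ρ g⁻¹ v)) • MonoidAlgebra.single g 1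
  map_add' v w := by simp only [map_add, mul_add, add_smul, Finset.sum_add_distrib]
  map_smul' a v := by
    simp only [map_smul, smul_eq_mul, Finset.smul_sum, smul_smul, RingHom.id_apply]
    exact Finset.sum_congr rfl fun g _ => by congr 1; ring

theorem matrixUnit_apply (ξ : V →ₗ[ℂ] ℂ) (v : V) :
    matrixUnit ρ ξ v = ∑ g, (unitScalar K V * ξ (ρ g⁻¹ v)) • MonoidAlgebra.single g (1 : ℂ) := rfl

theorem matrixUnit_smul_left (a : ℂ) (ξ : V →ₗ[ℂ] ℂ) (v : V) :
    matrixUnit ρ (a • ξ) v = a • matrixUnit ρ ξ v := by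
  simp only [matrixUnit_apply, Finset.smul_sum, smul_smul, LinearMap.smul_apply, smul_eq_mul]
  exact Finset.sum_congr rfl fun g _ => by congr 1; ring

theorem single_mul_matrixUnit (k : K) (ξ : V →ₗ[ℂ] ℂ) (v : V) :
    MonoidAlgebra.single k 1 * matrixUnit ρ ξ v = matrixUnit ρ ξ (ρ k v) := by
  simp only [matrixUnit_apply, Finset.mul_sum, mul_smul_comm, MonoidAlgebra.single_mul_single,
    one_mul]
  refine Fintype.sum_equiv (Equiv.mulLeft k) _ _ fun g => ?_
  simp only [Equiv.coe_mulLeft, ← Module.End.mul_apply, ← map_mul]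
  simp

theorem matrixUnit_mul_single (k : K) (ξ : V →ₗ[ℂ] ℂ) (v : V) :
    matrixUnit ρ ξ v * MonoidAlgebra.single k 1 = matrixUnit ρ (ξ ∘ₗ ρ k) v := by
  simp only [matrixUnit_apply, Finset.sum_mul, smul_mul_assoc, MonoidAlgebra.single_mul_single,
    one_mul]
  refine Fintype.sum_equiv (Equiv.mulRight k) _ _ fun g => ?_
  simp only [Equiv.coe_mulRight, LinearMap.comp_apply, ← Module.End.mul_apply, ← map_mul]
  simp

theorem mul_matrixUnit (x : MonoidAlgebra ℂ K) (ξ : V →ₗ[ℂ] ℂ) (v : V) :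
    x * matrixUnit ρ ξ v = matrixUnit ρ ξ (ρ.asAlgebraHom x v) := by
  induction x using MonoidAlgebra.induction_on with
  | of k => rw [MonoidAlgebra.of_apply, single_mul_matrixUnit,
      Representation.asAlgebraHom_single_one]
  | add x y hx hy => rw [add_mul, hx, hy, map_add, LinearMap.add_apply, map_add]
  | smul r x hx => rw [smul_mul_assoc, hx, map_smul, LinearMap.smul_apply, map_smul]

theorem asAlgebraHom_matrixUnit_apply (ξ : V →ₗ[ℂ] ℂ) (v : V) (w : W) :
    σ.asAlgebraHom (matrixUnit ρ ξ v) w =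
      unitScalar K V • (∑ g, σ g ∘ₗ (ξ.smulRight w) ∘ₗ ρ g⁻¹) v := by
  simp [matrixUnit_apply, Finset.smul_sum, smul_smul]

theorem IsIrredRep.asAlgebraHom_matrixUnit_of_not_repIso (hρ : IsIrredRep ρ) (hσ : IsIrredRep σ)
    (h : ¬ RepIso ρ σ) (ξ : V →ₗ[ℂ] ℂ) (v : V) (w : W) :
    σ.asAlgebraHom (matrixUnit ρ ξ v) w = 0 := by
  rw [asAlgebraHom_matrixUnit_apply, hρ.sum_conj_eq_zero hσ h, LinearMap.zero_apply, smul_zero]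

theorem IsIrredRep.asAlgebraHom_matrixUnit [FiniteDimensional ℂ V] (hρ : IsIrredRep ρ)
    (ξ : V →ₗ[ℂ] ℂ) (v w : V) : ρ.asAlgebraHom (matrixUnit ρ ξ v) w = ξ w • v := by
  rw [asAlgebraHom_matrixUnit_apply, ← LinearMap.smul_apply, hρ.smul_sum_conj,
    LinearMap.trace_smulRight]
  rfl

theorem eq_zero_of_forall_irred (x : MonoidAlgebra ℂ K)
    (hx : ∀ (W : Type) [AddCommGroup W] [Module ℂ W] [FiniteDimensional ℂ W]
      (σ : Representation ℂ K W), IsIrredRep σ → σ.asAlgebraHom x = 0) : x = 0 := by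
  have : NeZero (Nat.card K : ℂ) := ⟨by exact_mod_cast Nat.card_pos.ne'⟩
  have htop := IsSemisimpleModule.sSup_simples_eq_top (MonoidAlgebra ℂ K) (MonoidAlgebra ℂ K)
  have hmem : (1 : MonoidAlgebra ℂ K) ∈
      sSup {m : Submodule (MonoidAlgebra ℂ K) (MonoidAlgebra ℂ K) |
        IsSimpleModule (MonoidAlgebra ℂ K) m} := htop ▸ Submodule.mem_top
  suffices x * 1 = 0 by rwa [mul_one] at this
  rw [sSup_eq_iSup'] at hmem
  refine Submodule.iSup_induction _ (motive := fun m => x * m = 0) hmem ?_ (mul_zero _)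
    fun a b ha hb => by rw [mul_add, ha, hb, add_zero]
  rintro ⟨S, hS⟩ m hm
  have : IsSimpleModule (MonoidAlgebra ℂ K) S := hS
  let τ : Representation ℂ K S := Representation.ofModule' S
  have hτ (y : MonoidAlgebra ℂ K) (s : S) : τ.asAlgebraHom y s = y • s := by
    have : τ.asAlgebraHom = Algebra.lsmul ℂ ℂ S := by
      simp [τ, Representation.asAlgebraHom_def, Representation.ofModule']
    rw [this]
    rfl
  have : FiniteDimensional ℂ (MonoidAlgebra ℂ K) := inferInstance
  have : FiniteDimensional ℂ S := inferInstanceAs (FiniteDimensional ℂ (S.restrictScalars ℂ))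
  have hirr : IsIrredRep τ := by
    refine ⟨IsSimpleModule.nontrivial (MonoidAlgebra ℂ K) S, fun W hW => ?_⟩
    let W' : Submodule (MonoidAlgebra ℂ K) S := MonoidAlgebra.submoduleOfSMulMem W
      fun g v hv => by
        rw [← hτ, MonoidAlgebra.of_apply, Representation.asAlgebraHom_single_one]
        exact hW g v hv
    have hW' (v : S) : v ∈ W' ↔ v ∈ W := Iff.rfl
    rcases eq_bot_or_eq_top W' with h | h
    · left
      ext v
      rw [← hW', h, Submodule.mem_bot, Submodule.mem_bot]
    · right
      ext v
      rw [← hW', h]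
      exact iff_of_true Submodule.mem_top Submodule.mem_top
  have := hτ x ⟨m, hm⟩
  rw [hx S τ hirr] at this
  exact (congrArg Subtype.val this).symm


theorem sum_matrixUnit_eq_one {Ghat : Type} [Fintype Ghat] (V : Ghat → Type)
    [∀ r, AddCommGroup (V r)] [∀ r, Module ℂ (V r)] [∀ r, FiniteDimensional ℂ (V r)]
    (ρ : ∀ r, Representation ℂ K (V r)) (hirr : ∀ r, IsIrredRep (ρ r))
    (hdist : ∀ r r', RepIso (ρ r) (ρ r') → r = r')
    (hcomplete : ∀ (W : Type) [AddCommGroup W] [Module ℂ W] [FiniteDimensional ℂ W]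
      (σ : Representation ℂ K W), IsIrredRep σ → ∃ r, RepIso σ (ρ r)) :
    ∑ r, ∑ k, matrixUnit (ρ r) ((Module.finBasis ℂ (V r)).coord k) (Module.finBasis ℂ (V r) k) =
      1 := by
  rw [← sub_eq_zero]
  refine eq_zero_of_forall_irred _ fun W _ _ _ σ hσ => ?_
  obtain ⟨r, e, he⟩ := hcomplete W σ hσ
  ext w
  apply e.injective
  rw [repIso_asAlgebraHom he, LinearMap.zero_apply, map_zero, map_sub, map_one,
    LinearMap.sub_apply, Module.End.one_apply, sub_eq_zero, map_sum, LinearMap.sum_apply,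
    Finset.sum_eq_single r]
  · rw [map_sum, LinearMap.sum_apply]
    simp_rw [(hirr r).asAlgebraHom_matrixUnit, Module.Basis.coord_apply]
    exact Module.Basis.sum_repr _ _
  · intro r' _ h
    rw [map_sum, LinearMap.sum_apply]
    exact Finset.sum_eq_zero fun k _ =>
      (hirr r').asAlgebraHom_matrixUnit_of_not_repIso (hirr r) (fun h' => h (hdist _ _ h')) _ _ _
  · simp

end GroupAlgebra

section KernelUnits

variable {H Q : Type} [Group H] [Group Q] (j : H →* Q)

/-- The inclusion of the group algebra of `ker j` in that of `H`. -/
def kerIncl : MonoidAlgebra ℂ j.ker →ₐ[ℂ] MonoidAlgebra ℂ H :=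
  MonoidAlgebra.mapDomainAlgHom ℂ ℂ j.ker.subtype

theorem kerIncl_single (g : j.ker) (a : ℂ) :
    kerIncl j (MonoidAlgebra.single g a) = MonoidAlgebra.single (g : H) a :=
  MonoidAlgebra.mapDomain_single

theorem coeff_kerIncl_coe (x : MonoidAlgebra ℂ j.ker) (g : j.ker) :
    (kerIncl j x).coeff (g : H) = x.coeff g :=
  Finsupp.mapDomain_apply Subtype.val_injective x.coeff g

theorem coeff_kerIncl_of_notMem (x : MonoidAlgebra ℂ j.ker) {h : H} (hh : h ∉ j.ker) :
    (kerIncl j x).coeff h = 0 :=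
  Finsupp.mapDomain_of_notMem_range x.coeff h (by rintro ⟨g, rfl⟩; exact hh g.2)

variable {j} in
theorem single_mul_kerIncl_matrixUnit [Fintype j.ker] {V W : Type} [AddCommGroup V] [Module ℂ V]
    [AddCommGroup W] [Module ℂ W] {ρ : Representation ℂ j.ker V} {σ : Representation ℂ j.ker W}
    {h : H} {T : V ≃ₗ[ℂ] W} (hT : ∀ g v, T (conjRep j ρ h g v) = σ g (T v))
    (ξ : W →ₗ[ℂ] ℂ) (v : V) :
    MonoidAlgebra.single h 1 * kerIncl j (matrixUnit σ ξ (T v)) =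
      kerIncl j (matrixUnit ρ (ξ ∘ₗ T) v) * MonoidAlgebra.single h 1 := by
  have hd : unitScalar j.ker V = unitScalar j.ker W := by
    rw [unitScalar, unitScalar, T.finrank_eq]
  simp only [matrixUnit_apply, map_sum, map_smul, kerIncl_single, Finset.mul_sum, Finset.sum_mul,
    mul_smul_comm, smul_mul_assoc, MonoidAlgebra.single_mul_single, one_mul]
  refine Fintype.sum_equiv (MulAut.conjNormal h).toEquiv _ _ fun g => ?_
  rw [← hT, hd]
  have h1 : (((MulAut.conjNormal h).toEquiv g : j.ker) : H) * h = h * g := by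
    simp [MulAut.conjNormal_apply]
  rw [h1]
  simp [conjRep]

variable {Ghat : Type} {V : Ghat → Type} [∀ r, AddCommGroup (V r)] [∀ r, Module ℂ (V r)]
  {s : Q → H} {ρ : ∀ r, Representation ℂ j.ker (V r)} {act : Q → Ghat → Ghat}
  {T : ∀ (q : Q) (r : Ghat), V r ≃ₗ[ℂ] V (act q r)}

theorem apply_castHom (ξ : ∀ r, V r →ₗ[ℂ] ℂ) {a b : Ghat} (h : a = b) (x : V a) :
    ξ b (castHom V h x) = ξ a x := by
  subst h
  rfl

variable [Fintype j.ker] (s ρ T) (ξ : ∀ r, V r →ₗ[ℂ] ℂ) (v : ∀ r, V r)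

/-- The element of the group algebra of `H` to which `δ_r ⊗ q` is sent. -/
def crossUnit (q : Q) (r : Ghat) : MonoidAlgebra ℂ H :=
  kerIncl j (matrixUnit (ρ r) (ξ (act q r) ∘ₗ T q r) (v r)) * MonoidAlgebra.single (s q) 1

/-- The idempotent of the group algebra of `ker j` that has rank one on each `V r`. -/
def rankOneIdem [Fintype Ghat] : MonoidAlgebra ℂ j.ker := ∑ r, matrixUnit (ρ r) (ξ r) (v r)

variable {j s ρ T ξ v}

theorem matrixUnit_mul_matrixUnit_of_ne {r r' : Ghat} (hirr : ∀ r, IsIrredRep (ρ r))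
    (hdist : ∀ r r', RepIso (ρ r) (ρ r') → r = r') (h : r ≠ r')
    (η : V r →ₗ[ℂ] ℂ) (η' : V r' →ₗ[ℂ] ℂ) (w : V r) (w' : V r') :
    matrixUnit (ρ r) η w * matrixUnit (ρ r') η' w' = 0 := by
  rw [mul_matrixUnit, (hirr r).asAlgebraHom_matrixUnit_of_not_repIso (hirr r')
    (fun h' => h (hdist _ _ h')), map_zero]

theorem crossUnit_eq_single_mul
    (hT : ∀ (q : Q) (r : Ghat) (g : j.ker) (w : V r),
      T q r (conjRep j (ρ r) (s q) g w) = ρ (act q r) g (T q r w)) (q : Q) (r : Ghat) :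
    crossUnit j s ρ T ξ v q r = MonoidAlgebra.single (s q) 1 *
      kerIncl j (matrixUnit (ρ (act q r)) (ξ (act q r)) (T q r (v r))) :=
  (single_mul_kerIncl_matrixUnit (hT q r) _ _).symm

theorem crossUnit_mul_crossUnit_of_ne (hirr : ∀ r, IsIrredRep (ρ r))
    (hdist : ∀ r r', RepIso (ρ r) (ρ r') → r = r')
    (hT : ∀ (q : Q) (r : Ghat) (g : j.ker) (w : V r),
      T q r (conjRep j (ρ r) (s q) g w) = ρ (act q r) g (T q r w))
    (q₁ q₂ : Q) {r r' : Ghat} (h : r' ≠ act q₁ r) :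
    crossUnit j s ρ T ξ v q₁ r * crossUnit j s ρ T ξ v q₂ r' = 0 := by
  rw [crossUnit_eq_single_mul hT, crossUnit, mul_assoc, ← mul_assoc (kerIncl j _), ← map_mul,
    matrixUnit_mul_matrixUnit_of_ne hirr hdist h.symm, map_zero, zero_mul, mul_zero]

variable [∀ r, FiniteDimensional ℂ (V r)]

theorem matrixUnit_mul_matrixUnit {r : Ghat} (hirr : ∀ r, IsIrredRep (ρ r))
    (η η' : V r →ₗ[ℂ] ℂ) (w w' : V r) :
    matrixUnit (ρ r) η w * matrixUnit (ρ r) η' w' = η w' • matrixUnit (ρ r) η' w := by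
  rw [mul_matrixUnit, (hirr r).asAlgebraHom_matrixUnit, map_smul]

theorem rankOneIdem_mul_matrixUnit [Fintype Ghat] (hirr : ∀ r, IsIrredRep (ρ r))
    (hdist : ∀ r r', RepIso (ρ r) (ρ r') → r = r') {r : Ghat} (η : V r →ₗ[ℂ] ℂ) (w : V r) :
    rankOneIdem j ρ ξ v * matrixUnit (ρ r) η w = ξ r w • matrixUnit (ρ r) η (v r) := by
  rw [rankOneIdem, Finset.sum_mul, Finset.sum_eq_single r]
  · exact matrixUnit_mul_matrixUnit hirr _ _ _ _
  · exact fun r' _ h => matrixUnit_mul_matrixUnit_of_ne hirr hdist h _ _ _ _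
  · simp

theorem matrixUnit_mul_rankOneIdem [Fintype Ghat] (hirr : ∀ r, IsIrredRep (ρ r))
    (hdist : ∀ r r', RepIso (ρ r) (ρ r') → r = r') {r : Ghat} (η : V r →ₗ[ℂ] ℂ) (w : V r) :
    matrixUnit (ρ r) η w * rankOneIdem j ρ ξ v = η (v r) • matrixUnit (ρ r) (ξ r) w := by
  rw [rankOneIdem, Finset.mul_sum, Finset.sum_eq_single r]
  · exact matrixUnit_mul_matrixUnit hirr _ _ _ _
  · exact fun r' _ h => matrixUnit_mul_matrixUnit_of_ne hirr hdist h.symm _ _ _ _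
  · simp

theorem rankOneIdem_mul_self [Fintype Ghat] (hirr : ∀ r, IsIrredRep (ρ r))
    (hdist : ∀ r r', RepIso (ρ r) (ρ r') → r = r') (hξ : ∀ r, ξ r (v r) = 1) :
    rankOneIdem j ρ ξ v * rankOneIdem j ρ ξ v = rankOneIdem j ρ ξ v := by
  have : rankOneIdem j ρ ξ v * ∑ r, matrixUnit (ρ r) (ξ r) (v r) =
      ∑ r, matrixUnit (ρ r) (ξ r) (v r) := by
    rw [Finset.mul_sum]
    refine Finset.sum_congr rfl fun r _ => ?_
    rw [rankOneIdem_mul_matrixUnit hirr hdist, hξ, one_smul]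
  exact this

theorem crossUnit_mul_rankOneIdem [Fintype Ghat] (hirr : ∀ r, IsIrredRep (ρ r))
    (hdist : ∀ r r', RepIso (ρ r) (ρ r') → r = r') (hξ : ∀ r, ξ r (v r) = 1)
    (hT : ∀ (q : Q) (r : Ghat) (g : j.ker) (w : V r),
      T q r (conjRep j (ρ r) (s q) g w) = ρ (act q r) g (T q r w)) (q : Q) (r : Ghat) :
    crossUnit j s ρ T ξ v q r * kerIncl j (rankOneIdem j ρ ξ v) =
      crossUnit j s ρ T ξ v q r := by
  rw [crossUnit_eq_single_mul hT, mul_assoc, ← map_mul, matrixUnit_mul_rankOneIdem hirr hdist, hξ,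
    one_smul]

theorem crossUnit_mul_crossUnit (hirr : ∀ r, IsIrredRep (ρ r)) (hξ : ∀ r, ξ r (v r) = 1)
    (hs : ∀ q, j (s q) = q)
    (hactmul : ∀ (q₁ q₂ : Q) (r : Ghat), act q₂ (act q₁ r) = act (q₁ * q₂) r)
    (hT : ∀ (q : Q) (r : Ghat) (g : j.ker) (w : V r),
      T q r (conjRep j (ρ r) (s q) g w) = ρ (act q r) g (T q r w))
    {c : Ghat → Q → Q → ℂ}
    (hcdef : ∀ (r : Ghat) (q₁ q₂ : Q) (w : V r),
      T q₂ (act q₁ r) (T q₁ r w) =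
        c r q₁ q₂ • castHom V (hactmul q₁ q₂ r).symm
          (T (q₁ * q₂) r (ρ r ((tau j s hs q₁ q₂)⁻¹) w)))
    (q₁ q₂ : Q) (r : Ghat) :
    crossUnit j s ρ T ξ v q₁ r * crossUnit j s ρ T ξ v q₂ (act q₁ r) =
      c r q₁ q₂ • crossUnit j s ρ T ξ v (q₁ * q₂) r := by
  have h1 := single_mul_kerIncl_matrixUnit (hT q₁ r) (ξ (act q₂ (act q₁ r)) ∘ₗ T q₂ (act q₁ r))
    ((T q₁ r).symm (v (act q₁ r)))
  rw [LinearEquiv.apply_symm_apply] at h1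
  have h2 : MonoidAlgebra.single (s q₁) (1 : ℂ) * MonoidAlgebra.single (s q₂) 1 =
      kerIncl j (MonoidAlgebra.single (tau j s hs q₁ q₂) 1) *
        MonoidAlgebra.single (s (q₁ * q₂)) 1 := by
    rw [kerIncl_single, MonoidAlgebra.single_mul_single, MonoidAlgebra.single_mul_single]
    simp [tau]
  have h3 : (((ξ (act q₂ (act q₁ r)) ∘ₗ (T q₂ (act q₁ r)).toLinearMap) ∘ₗ
      (T q₁ r).toLinearMap) ∘ₗ ρ r (tau j s hs q₁ q₂)) =
      c r q₁ q₂ • (ξ (act (q₁ * q₂) r) ∘ₗ (T (q₁ * q₂) r).toLinearMap) := by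
    ext w
    simp only [LinearMap.comp_apply, LinearEquiv.coe_coe, hcdef, map_smul, apply_castHom,
      LinearMap.smul_apply]
    rw [← Module.End.mul_apply (ρ r _), ← map_mul, inv_mul_cancel, map_one, Module.End.one_apply]
  rw [crossUnit, crossUnit, mul_assoc, ← mul_assoc (MonoidAlgebra.single (s q₁) _), h1,
    mul_assoc, h2, ← mul_assoc, ← mul_assoc, ← map_mul, matrixUnit_mul_matrixUnit hirr,
    LinearMap.comp_apply, LinearEquiv.coe_coe, LinearEquiv.apply_symm_apply, hξ, one_smul,
    ← map_mul, matrixUnit_mul_single, h3, matrixUnit_smul_left, map_smul, smul_mul_assoc,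
    crossUnit]

theorem rankOneIdem_mul_single_mul_rankOneIdem [Fintype Ghat] (hirr : ∀ r, IsIrredRep (ρ r))
    (hdist : ∀ r r', RepIso (ρ r) (ρ r') → r = r') (hs : ∀ q, j (s q) = q)
    (hact : ∀ q, Function.Bijective (act q))
    (hT : ∀ (q : Q) (r : Ghat) (g : j.ker) (w : V r),
      T q r (conjRep j (ρ r) (s q) g w) = ρ (act q r) g (T q r w)) (h : H) :
    ∃ κ : Ghat → ℂ, kerIncl j (rankOneIdem j ρ ξ v) * MonoidAlgebra.single h 1 *
      kerIncl j (rankOneIdem j ρ ξ v) = ∑ r, κ r • crossUnit j s ρ T ξ v (j h) r := by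
  let g : j.ker := ⟨h * (s (j h))⁻¹, by simp [MonoidHom.mem_ker, hs]⟩
  have hg : MonoidAlgebra.single h (1 : ℂ) =
      kerIncl j (MonoidAlgebra.single g 1) * MonoidAlgebra.single (s (j h)) 1 := by
    rw [kerIncl_single, MonoidAlgebra.single_mul_single]
    simp [g]
  refine ⟨fun r => ξ r (ρ r g ((T (j h) r).symm (v (act (j h) r)))), ?_⟩
  have h1 : MonoidAlgebra.single (s (j h)) (1 : ℂ) * kerIncl j (rankOneIdem j ρ ξ v) =
      ∑ r, kerIncl j (matrixUnit (ρ r) (ξ (act (j h) r) ∘ₗ T (j h) r)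
        ((T (j h) r).symm (v (act (j h) r)))) * MonoidAlgebra.single (s (j h)) 1 := by
    rw [rankOneIdem, map_sum, Finset.mul_sum, ← (Equiv.ofBijective _ (hact (j h))).sum_comp]
    refine Finset.sum_congr rfl fun r _ => ?_
    rw [← single_mul_kerIncl_matrixUnit (hT (j h) r), LinearEquiv.apply_symm_apply]
    rfl
  rw [hg, mul_assoc, mul_assoc (kerIncl j _), h1, Finset.mul_sum, Finset.mul_sum]
  refine Finset.sum_congr rfl fun r _ => ?_
  rw [← mul_assoc (kerIncl j (MonoidAlgebra.single g 1)), ← map_mul, single_mul_matrixUnit,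
    ← mul_assoc, ← map_mul, rankOneIdem_mul_matrixUnit hirr hdist, map_smul, smul_mul_assoc,
    crossUnit]

theorem linearIndependent_crossUnit (hirr : ∀ r, IsIrredRep (ρ r))
    (hdist : ∀ r r', RepIso (ρ r) (ρ r') → r = r') (hs : ∀ q, j (s q) = q)
    (hξ : ∀ r, ξ r (v r) = 1) [Fintype Q] [Fintype Ghat] :
    LinearIndependent ℂ fun p : Q × Ghat => crossUnit j s ρ T ξ v p.1 p.2 := by
  rw [Fintype.linearIndependent_iff]
  rintro a ha ⟨q, r⟩
  have h1 (q' : Q) (r' : Ghat) (g : j.ker) (hq : q' ≠ q) :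
      (crossUnit j s ρ T ξ v q' r').coeff (g * s q) = 0 := by
    rw [crossUnit, MonoidAlgebra.coeff_mul_single_apply, coeff_kerIncl_of_notMem, zero_mul]
    simp only [MonoidHom.mem_ker, map_mul, map_inv, hs, MonoidHom.mem_ker.1 g.2, one_mul]
    rw [mul_inv_eq_one]
    exact hq.symm
  have h2 (r' : Ghat) (g : j.ker) : (crossUnit j s ρ T ξ v q r').coeff (g * s q) =
      (matrixUnit (ρ r') (ξ (act q r') ∘ₗ T q r') (v r')).coeff g := by
    rw [crossUnit, MonoidAlgebra.coeff_mul_single_apply, mul_inv_cancel_right, coeff_kerIncl_coe,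
      mul_one]
  have h3 : ∑ r', a (q, r') • matrixUnit (ρ r') (ξ (act q r') ∘ₗ T q r') (v r') = 0 := by
    apply MonoidAlgebra.coeff_injective
    ext g
    have := congrArg (fun x : MonoidAlgebra ℂ H => x.coeff (g * s q)) ha
    simp only [MonoidAlgebra.coeff_sum, Finsupp.finsetSum_apply, MonoidAlgebra.coeff_smul_apply,
      Fintype.sum_prod_type] at this ⊢
    rw [Finset.sum_eq_single q (fun q' _ h => Finset.sum_eq_zero fun r' _ => by
      rw [h1 q' r' g h, smul_zero]) (by simp)] at this
    simpa only [h2, MonoidAlgebra.coeff_zero, Finsupp.coe_zero, Pi.zero_apply] using this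
  have h4 := congrArg (fun x => ξ r ((ρ r).asAlgebraHom x ((T q r).symm (v (act q r))))) h3
  simp only [map_sum, map_smul, LinearMap.sum_apply, LinearMap.smul_apply] at h4
  rw [Finset.sum_eq_single r (fun r' _ h => by
    rw [(hirr r').asAlgebraHom_matrixUnit_of_not_repIso (hirr r)
      (fun h' => h (hdist _ _ h')), map_zero, smul_zero]) (by simp),
    (hirr r).asAlgebraHom_matrixUnit] at h4
  simpa [hξ] using h4

end KernelUnits

section Corner

open CategoryTheory

variable {B C : Type} [Ring B] [Ring C] [Algebra ℂ B] [Algebra ℂ C] (i : C →ₙₐ[ℂ] B)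

/-- The part of a `B`-module fixed by the idempotent `i 1`, for a non-unital map `i : C → B`. -/
def cornerPart (M : Type) [AddCommGroup M] [Module B M] : AddSubgroup M where
  carrier := {m | i 1 • m = m}
  zero_mem' := smul_zero _
  add_mem' {a b} ha hb := by
    change i 1 • (a + b) = a + b
    rw [smul_add, show i 1 • a = a from ha, show i 1 • b = b from hb]
  neg_mem' {a} ha := by
    change i 1 • (-a) = -a
    rw [smul_neg, show i 1 • a = a from ha]

variable {i} in
theorem mem_cornerPart {M : Type} [AddCommGroup M] [Module B M] {m : M} :
    m ∈ cornerPart i M ↔ i 1 • m = m := Iff.rfl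

theorem smul_mem_cornerPart {M : Type} [AddCommGroup M] [Module B M] (c : C) (m : M) :
    i c • m ∈ cornerPart i M := by
  rw [mem_cornerPart, smul_smul, ← map_mul, one_mul]

instance cornerPart.instModule (M : Type) [AddCommGroup M] [Module B M] :
    Module C (cornerPart i M) where
  smul c m := ⟨i c • (m : M), smul_mem_cornerPart i c _⟩
  one_smul m := Subtype.ext m.2
  mul_smul a b m := Subtype.ext <| by
    change i (a * b) • (m : M) = i a • i b • (m : M)
    rw [map_mul, mul_smul]
  smul_zero a := Subtype.ext <| smul_zero (A := M) (i a)
  smul_add a m n := Subtype.ext <| smul_add (i a) (m : M) n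
  add_smul a b m := Subtype.ext <| by
    change i (a + b) • (m : M) = i a • (m : M) + i b • (m : M)
    rw [map_add, add_smul]
  zero_smul m := Subtype.ext <| by
    change i 0 • (m : M) = 0
    rw [map_zero, zero_smul]

/-- The restriction of a `B`-linear map to the parts fixed by `i 1`. -/
def cornerPart.map {M N : Type} [AddCommGroup M] [Module B M] [AddCommGroup N] [Module B N]
    (f : M →ₗ[B] N) : cornerPart i M →ₗ[C] cornerPart i N where
  toFun m := ⟨f m, by rw [mem_cornerPart, ← map_smul, mem_cornerPart.1 m.2]⟩
  map_add' m n := Subtype.ext <| map_add f (m : M) n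
  map_smul' c m := Subtype.ext <| map_smul f (i c) (m : M)

/-- The functor `M ↦ e M` from `B`-modules to `C`-modules, for `e = i 1`. -/
def cornerFunctor : ModuleCat.{0} B ⥤ ModuleCat.{0} C where
  obj M := ModuleCat.of C (cornerPart i M)
  map f := ModuleCat.ofHom (cornerPart.map i f.hom)

instance cornerFunctor.instAdditive : (cornerFunctor i).Additive where
  map_add := rfl

instance cornerFunctor.instLinear : (cornerFunctor i).Linear ℂ where
  map_smul {M N} f r := by
    refine ModuleCat.hom_ext (LinearMap.ext fun (m : cornerPart i M) => Subtype.ext ?_)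
    change algebraMap ℂ B r • f.hom (m : M) = i (algebraMap ℂ C r) • f.hom (m : M)
    have h : i 1 • f.hom (m : M) = f.hom (m : M) := by
      rw [← map_smul, mem_cornerPart.1 m.2]
    rw [Algebra.algebraMap_eq_smul_one (A := C), map_smul, Algebra.algebraMap_eq_smul_one, ← h,
      smul_smul, smul_smul, smul_mul_assoc, smul_mul_assoc, ← map_mul, one_mul, one_mul]

variable {ι : Type} [Fintype ι] {x y : ι → B}

theorem cornerFunctor_faithful (hfull : ∑ k, x k * i 1 * y k = 1) :
    (cornerFunctor i).Faithful where
  map_injective {M N} f g h := by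
    refine ModuleCat.hom_ext (LinearMap.ext fun m => ?_)
    have key (m : M) : f.hom (i 1 • m) = g.hom (i 1 • m) :=
      congrArg (fun φ => ((φ.hom ⟨_, smul_mem_cornerPart i 1 m⟩ : cornerPart i N) : N)) h
    rw [← one_smul B m, ← hfull, Finset.sum_smul, map_sum, map_sum]
    refine Finset.sum_congr rfl fun k _ => ?_
    rw [mul_smul, mul_smul, map_smul f.hom, map_smul g.hom, key]


theorem cornerFunctor_full (hfull : ∑ k, x k * i 1 * y k = 1)
    (hrange : ∀ b, ∃ c, i c = i 1 * b * i 1) : (cornerFunctor i).Full where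
  map_surjective {M N} f := by
    let φ : cornerPart i M →ₗ[C] cornerPart i N := f.hom
    have hlin (c : C) (m : cornerPart i M) :
        (φ (c • m) : N) = i c • (φ m : N) :=
      congrArg Subtype.val (map_smul φ c m)
    let p (m : M) : cornerPart i M := ⟨i 1 • m, smul_mem_cornerPart i 1 m⟩
    have hp (m n : M) : p (m + n) = p m + p n := Subtype.ext (smul_add _ _ _)
    let g (m : M) : N := (φ (p m) : N)
    have hg (m n : M) : g (m + n) = g m + g n := by
      change (φ (p (m + n)) : N) = _
      rw [hp, map_add]
      rfl
    have hge (m : M) : i 1 • g m = g m := mem_cornerPart.1 (φ (p m)).2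
    have hgs (b : B) (m : M) : g (b • i 1 • m) = i 1 • b • g m := by
      obtain ⟨c, hc⟩ := hrange b
      have : p (b • i 1 • m) = c • p m := Subtype.ext <| by
        change i 1 • b • i 1 • m = i c • i 1 • m
        rw [hc, ← mul_smul, ← mul_smul, ← mul_smul, mul_assoc (i 1 * b), ← map_mul, one_mul]
      change (φ (p (b • i 1 • m)) : N) = _
      rw [this, hlin, hc, mul_smul, mul_smul]
      exact congrArg (fun n => i 1 • b • n) (hge m)
    let gHom : M →+ N := AddMonoidHom.mk' g hg
    have hsum (b : B) (m : M) : ∑ k, x k • g (y k • b • m) = b • ∑ k, x k • g (y k • m) := by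
      have h1 (k : ι) : g (y k • b • m) = ∑ l, i 1 • y k • b • x l • g (y l • m) := by
        conv_lhs => rw [← one_smul B m, ← hfull, Finset.sum_smul, Finset.smul_sum,
          Finset.smul_sum]
        refine (map_sum gHom _ _).trans (Finset.sum_congr rfl fun l _ => ?_)
        change g _ = _
        have := hgs (y k * b * x l) (y l • m)
        simpa only [mul_smul] using this
      simp_rw [h1, Finset.smul_sum]
      rw [Finset.sum_comm]
      refine Finset.sum_congr rfl fun l _ => ?_
      conv_rhs => rw [← one_smul B (b • x l • g (y l • m)), ← hfull, Finset.sum_smul]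
      simp only [mul_smul]
    let F : M →ₗ[B] N :=
      { toFun := fun m => ∑ k, x k • g (y k • m)
        map_add' := fun m n => by simp only [smul_add, hg, Finset.sum_add_distrib]
        map_smul' := hsum }
    refine ⟨ModuleCat.ofHom F, ModuleCat.hom_ext (LinearMap.ext fun (m : cornerPart i M) =>
      Subtype.ext ?_)⟩
    change ∑ k, x k • g (y k • (m : M)) = (φ m : N)
    have hm : i 1 • (m : M) = m := mem_cornerPart.1 m.2
    have hgm : (φ m : N) = g m :=
      congrArg (fun m => (φ m : N)) (Subtype.ext hm.symm)
    have h2 (k : ι) : g (y k • (m : M)) = i 1 • y k • g m := by rw [← hgs, hm]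
    simp_rw [h2]
    rw [hgm]
    conv_rhs => rw [← one_smul B (g m), ← hfull, Finset.sum_smul]
    simp only [mul_smul]

/-- The `B`-module of additive maps `B → N` that are `C`-linear along `i`. -/
def cornerCoind (N : Type) [AddCommGroup N] [Module C N] : AddSubgroup (B →+ N) where
  carrier := {f | ∀ c b, f (i c * b) = c • f b}
  zero_mem' c b := (smul_zero c).symm
  add_mem' {f g} hf hg c b := by
    change f _ + g _ = c • (f b + g b)
    rw [hf, hg, smul_add]
  neg_mem' {f} hf c b := by
    change -f _ = c • -f b
    rw [hf, smul_neg]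

instance cornerCoind.instModule (N : Type) [AddCommGroup N] [Module C N] :
    Module B (cornerCoind i N) where
  smul b f := ⟨(f : B →+ N).comp (AddMonoidHom.mulRight b), fun c b' => by
    change (f : B →+ N) (i c * b' * b) = c • (f : B →+ N) (b' * b)
    rw [mul_assoc, f.2]⟩
  one_smul f := Subtype.ext <| AddMonoidHom.ext fun b => congrArg f.1 (mul_one b)
  mul_smul a b f := Subtype.ext <| AddMonoidHom.ext fun x =>
    congrArg f.1 (mul_assoc x a b).symm
  smul_zero a := rfl
  smul_add a f g := rfl
  add_smul a b f := Subtype.ext <| AddMonoidHom.ext fun x =>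
    (congrArg f.1 (mul_add x a b)).trans (map_add f.1 _ _)
  zero_smul f := Subtype.ext <| AddMonoidHom.ext fun x =>
    (congrArg f.1 (mul_zero x)).trans (map_zero f.1)

theorem cornerCoind.smul_apply {N : Type} [AddCommGroup N] [Module C N] (b x : B)
    (f : cornerCoind i N) : (b • f : cornerCoind i N).1 x = f.1 (x * b) := rfl

theorem cornerFunctor_essSurj (hinj : Function.Injective i)
    (hrange : ∀ b, ∃ c, i c = i 1 * b * i 1) : (cornerFunctor i).EssSurj where
  mem_essImage N := by
    choose θ hθ using hrange
    have he : i 1 * i 1 = i 1 := by rw [← map_mul, one_mul]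
    let ev : cornerPart i (cornerCoind i N) →ₗ[C] N :=
      { toFun := fun f => f.1.1 1
        map_add' := fun f g => rfl
        map_smul' := fun c f => by
          change f.1.1 (1 * i c) = c • f.1.1 1
          rw [one_mul, ← f.1.2, mul_one] }
    have hfix (f : cornerPart i (cornerCoind i N)) (x : B) : f.1.1 x = θ x • f.1.1 1 := by
      have h1 : f.1.1 x = f.1.1 (x * i 1) :=
        (congrArg (fun g : cornerCoind i N => g.1 x) (mem_cornerPart.1 f.2)).symm
      rw [← f.1.2, hθ, mul_one, mul_assoc, f.1.2, one_smul, h1]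
    have hbij : Function.Bijective ev := by
      refine ⟨(injective_iff_map_eq_zero ev).2 fun f hf => ?_, fun n => ?_⟩
      · refine Subtype.ext (Subtype.ext (AddMonoidHom.ext fun x => ?_))
        rw [hfix, show f.1.1 1 = 0 from hf, smul_zero]
        rfl
      · let g : B →+ N := AddMonoidHom.mk' (fun x => θ x • n) fun x y => by
          rw [← add_smul]
          congr 1
          apply hinj
          rw [map_add, hθ, hθ, hθ, mul_add, add_mul]
        refine ⟨⟨⟨g, fun c b => ?_⟩, mem_cornerPart.2 (Subtype.ext (AddMonoidHom.ext
          fun x => ?_))⟩, ?_⟩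
        · change θ (i c * b) • n = c • θ b • n
          rw [← mul_smul]
          congr 1
          apply hinj
          rw [map_mul, hθ, hθ, ← mul_assoc, ← mul_assoc, ← mul_assoc, ← map_mul, ← map_mul,
            one_mul, mul_one]
        · change θ (x * i 1) • n = θ x • n
          congr 1
          apply hinj
          rw [hθ, hθ, mul_assoc, mul_assoc, he, mul_assoc]
        · change θ 1 • n = n
          conv_rhs => rw [← one_smul C n]
          congr 1
          apply hinj
          rw [hθ, mul_one, he]
    exact ⟨ModuleCat.of B (cornerCoind i N),
      ⟨(LinearEquiv.ofBijective ev hbij).toModuleIso⟩⟩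

theorem moritaEquiv_of_corner (hinj : Function.Injective i)
    (hrange : ∀ b, ∃ c, i c = i 1 * b * i 1) (hfull : ∑ k, x k * i 1 * y k = 1) :
    MoritaEquiv B C := by
  have := cornerFunctor_faithful i hfull
  have := cornerFunctor_full i hfull hrange
  have := cornerFunctor_essSurj i hinj hrange
  have : (cornerFunctor i).IsEquivalence := {}
  exact ⟨(cornerFunctor i).asEquivalence, cornerFunctor.instAdditive i,
    cornerFunctor.instLinear i⟩

end Corner

section CrossedProduct

theorem CrossH.exists_linearMap {H A : Type} [Group H] [Fintype H] [Ring A] [Algebra ℂ A]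
    (φ : H →* (A ≃ₐ[ℂ] A)) [Ring (CrossH H A)] [Algebra ℂ (CrossH H A)]
    (hadd : ∀ f₁ f₂ : CrossH H A, (f₁ + f₂).coef = fun h => f₁.coef h + f₂.coef h)
    (hsmul : ∀ (a : ℂ) (f : CrossH H A), (a • f).coef = fun h => a • f.coef h)
    (hmul : ∀ f₁ f₂ : CrossH H A, (f₁ * f₂).coef = fun h =>
      ∑ h₁ : H, f₁.coef h₁ * (φ h₁) (f₂.coef (h₁⁻¹ * h))) :
    ∃ D : A →ₗ[ℂ] MonoidAlgebra ℂ H →ₗ[ℂ] CrossH H A,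
      (∀ a a' h h', D a (MonoidAlgebra.single h 1) * D a' (MonoidAlgebra.single h' 1) =
        D (a * φ h a') (MonoidAlgebra.single (h * h') 1)) ∧
      (∀ b, ∃ β : H → A, b = ∑ h, D (β h) (MonoidAlgebra.single h 1)) ∧
      ∀ R : MonoidAlgebra ℂ H →ₗ[ℂ] ℂ, ∃ RA : CrossH H A →ₗ[ℂ] A,
        ∀ a x, RA (D a x) = R x • a := by
  classical
  have hext (f g : CrossH H A) (h : ∀ k, f.coef k = g.coef k) : f = g := by
    cases f; cases g; congr 1; exact funext h
  let C : CrossH H A →ₗ[ℂ] H → A :=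
    { toFun := CrossH.coef
      map_add' := hadd
      map_smul' := hsmul }
  let D : A →ₗ[ℂ] MonoidAlgebra ℂ H →ₗ[ℂ] CrossH H A :=
    LinearMap.mk₂ ℂ (fun a x => ⟨fun h => x.coeff h • a⟩)
      (fun a b x => hext _ _ fun k => by simp [hadd])
      (fun c a x => hext _ _ fun k => by simp [hsmul, smul_comm c])
      (fun a x y => hext _ _ fun k => by simp [hadd, add_smul])
      (fun c a x => hext _ _ fun k => by simp [hsmul, mul_smul])
  have hD (a : A) (x : MonoidAlgebra ℂ H) (h : H) : (D a x).coef h = x.coeff h • a := rfl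
  refine ⟨D, fun a a' h h' => hext _ _ fun k => ?_, fun b => ⟨b.coef, hext _ _ fun k => ?_⟩,
    fun R => ⟨∑ h, R (MonoidAlgebra.single h 1) • LinearMap.proj h ∘ₗ C, fun a x => ?_⟩⟩
  · simp only [hmul, hD, MonoidAlgebra.coeff_single, Finsupp.single_apply, ite_smul, one_smul,
      zero_smul, ite_mul, zero_mul, Finset.sum_ite_eq, Finset.mem_univ, if_true]
    by_cases hk : h * h' = k
    · rw [if_pos hk, if_pos (by rw [← hk, inv_mul_cancel_left])]
    · rw [if_neg hk, if_neg (fun h1 => hk (by rw [h1, mul_inv_cancel_left])), map_zero, mul_zero]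
  · change C b k = C (∑ h, D (b.coef h) (MonoidAlgebra.single h 1)) k
    rw [map_sum, Finset.sum_apply]
    change b.coef k = ∑ h, (D (b.coef h) (MonoidAlgebra.single h 1)).coef k
    simp [hD, Finsupp.single_apply]
  · have hx : R x = ∑ h, x.coeff h * R (MonoidAlgebra.single h 1) := by
      conv_lhs => rw [← MonoidAlgebra.sum_coeff_single x, Finsupp.sum_fintype _ _ (by simp),
        map_sum]
      refine Finset.sum_congr rfl fun h _ => ?_
      rw [← smul_eq_mul, ← map_smul, MonoidAlgebra.smul_single, smul_eq_mul, mul_one]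
    rw [LinearMap.sum_apply, hx, Finset.sum_smul]
    refine Finset.sum_congr rfl fun h _ => ?_
    change R (MonoidAlgebra.single h 1) • x.coeff h • a = _
    rw [smul_smul, mul_comm]

variable {H Q A B : Type} [Group H] [Group Q] {j : H →* Q} [Ring A] [Algebra ℂ A] [Ring B]
  [Algebra ℂ B] {φ : H →* (A ≃ₐ[ℂ] A)} {D : A →ₗ[ℂ] MonoidAlgebra ℂ H →ₗ[ℂ] B}

theorem apply_single_mul
    (hD : ∀ a a' h h', D a (MonoidAlgebra.single h 1) * D a' (MonoidAlgebra.single h' 1) =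
      D (a * φ h a') (MonoidAlgebra.single (h * h') 1)) (a a' : A) (h : H)
    (y : MonoidAlgebra ℂ H) :
    D a (MonoidAlgebra.single h 1) * D a' y = D (a * φ h a') (MonoidAlgebra.single h 1 * y) := by
  induction y using MonoidAlgebra.induction_on with
  | of k => rw [MonoidAlgebra.of_apply, hD, MonoidAlgebra.single_mul_single, one_mul]
  | add x y hx hy => rw [map_add, mul_add, hx, hy, mul_add, map_add]
  | smul r x hx => rw [map_smul, mul_smul_comm, hx, mul_smul_comm, map_smul]

theorem apply_kerIncl_mul (htriv : ∀ g : H, g ∈ j.ker → φ g = AlgEquiv.refl)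
    (hD : ∀ a a' h h', D a (MonoidAlgebra.single h 1) * D a' (MonoidAlgebra.single h' 1) =
      D (a * φ h a') (MonoidAlgebra.single (h * h') 1)) (a a' : A) (x : MonoidAlgebra ℂ j.ker)
    (h : H) (y : MonoidAlgebra ℂ H) :
    D a (kerIncl j x * MonoidAlgebra.single h 1) * D a' y =
      D (a * φ h a') (kerIncl j x * MonoidAlgebra.single h 1 * y) := by
  induction x using MonoidAlgebra.induction_on with
  | of k =>
    rw [MonoidAlgebra.of_apply, kerIncl_single, MonoidAlgebra.single_mul_single, one_mul,
      apply_single_mul hD, map_mul φ, htriv k k.2]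
    rfl
  | add x z hx hz => simp only [map_add, add_mul, hx, hz]
  | smul r x hx => simp only [map_smul, smul_mul_assoc, hx]

theorem apply_one_mul
    (hD : ∀ a a' h h', D a (MonoidAlgebra.single h 1) * D a' (MonoidAlgebra.single h' 1) =
      D (a * φ h a') (MonoidAlgebra.single (h * h') 1)) (x y : MonoidAlgebra ℂ H) :
    D 1 x * D 1 y = D 1 (x * y) := by
  induction x using MonoidAlgebra.induction_on with
  | of k => rw [MonoidAlgebra.of_apply, apply_single_mul hD, map_one, one_mul]
  | add x z hx hz => simp only [map_add, add_mul, hx, hz]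
  | smul r x hx => simp only [map_smul, smul_mul_assoc, hx]

theorem apply_kerIncl_mul' (htriv : ∀ g : H, g ∈ j.ker → φ g = AlgEquiv.refl)
    (hD : ∀ a a' h h', D a (MonoidAlgebra.single h 1) * D a' (MonoidAlgebra.single h' 1) =
      D (a * φ h a') (MonoidAlgebra.single (h * h') 1)) (a : A) (x : MonoidAlgebra ℂ j.ker)
    (y : MonoidAlgebra ℂ H) : D 1 (kerIncl j x) * D a y = D a (kerIncl j x * y) := by
  have := apply_kerIncl_mul htriv hD 1 a x 1 y
  rwa [← MonoidAlgebra.one_def, mul_one, map_one φ, AlgEquiv.one_apply, one_mul] at this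

theorem apply_one_one [Fintype H]
    (hD : ∀ a a' h h', D a (MonoidAlgebra.single h 1) * D a' (MonoidAlgebra.single h' 1) =
      D (a * φ h a') (MonoidAlgebra.single (h * h') 1))
    (hspan : ∀ b, ∃ β : H → A, b = ∑ h, D (β h) (MonoidAlgebra.single h 1)) : D 1 1 = 1 := by
  have key (b : B) : D 1 1 * b = b := by
    obtain ⟨β, rfl⟩ := hspan b
    rw [Finset.mul_sum]
    refine Finset.sum_congr rfl fun h _ => ?_
    rw [MonoidAlgebra.one_def, hD, map_one, one_mul, one_mul]
    rfl
  rw [← key 1, mul_one]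

variable {Ghat : Type} [Fintype Ghat] {V : Ghat → Type} [∀ r, AddCommGroup (V r)]
  [∀ r, Module ℂ (V r)] [∀ r, FiniteDimensional ℂ (V r)]
  {s : Q → H} {ρ : ∀ r, Representation ℂ j.ker (V r)} {act : Q → Ghat → Ghat}
  {T : ∀ (q : Q) (r : Ghat), V r ≃ₗ[ℂ] V (act q r)} {ξ : ∀ r, V r →ₗ[ℂ] ℂ} {v : ∀ r, V r}
  {c : Ghat → Q → Q → ℂ}

theorem exists_sum_mul_rankOneIdem_mul [Fintype j.ker] (hirr : ∀ r, IsIrredRep (ρ r))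
    (hdist : ∀ r r', RepIso (ρ r) (ρ r') → r = r')
    (hcomplete : ∀ (W : Type) [AddCommGroup W] [Module ℂ W] [FiniteDimensional ℂ W]
      (σ : Representation ℂ j.ker W), IsIrredRep σ → ∃ r, RepIso σ (ρ r))
    (hξ : ∀ r, ξ r (v r) = 1) :
    ∃ x y : (Σ r, Fin (Module.finrank ℂ (V r))) → MonoidAlgebra ℂ j.ker,
      ∑ k, x k * rankOneIdem j ρ ξ v * y k = 1 := by
  refine ⟨fun k => matrixUnit (ρ k.1) (ξ k.1) (Module.finBasis ℂ (V k.1) k.2),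
    fun k => matrixUnit (ρ k.1) ((Module.finBasis ℂ (V k.1)).coord k.2) (v k.1), ?_⟩
  rw [← sum_matrixUnit_eq_one V ρ hirr hdist hcomplete, Fintype.sum_sigma]
  refine Finset.sum_congr rfl fun r _ => Finset.sum_congr rfl fun k _ => ?_
  rw [matrixUnit_mul_rankOneIdem hirr hdist, hξ, one_smul, matrixUnit_mul_matrixUnit hirr, hξ,
    one_smul]

theorem moritaEquiv_crossQ [Fintype H] [Fintype Q] [Fintype j.ker]
    (hs : ∀ q, j (s q) = q) (hirr : ∀ r, IsIrredRep (ρ r))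
    (hdist : ∀ r r', RepIso (ρ r) (ρ r') → r = r')
    (hcomplete : ∀ (W : Type) [AddCommGroup W] [Module ℂ W] [FiniteDimensional ℂ W]
      (σ : Representation ℂ j.ker W), IsIrredRep σ → ∃ r, RepIso σ (ρ r))
    (hactmul : ∀ (q₁ q₂ : Q) (r : Ghat), act q₂ (act q₁ r) = act (q₁ * q₂) r)
    (hact : ∀ q, Function.Bijective (act q))
    (hT : ∀ (q : Q) (r : Ghat) (g : j.ker) (w : V r),
      T q r (conjRep j (ρ r) (s q) g w) = ρ (act q r) g (T q r w))
    (hcdef : ∀ (r : Ghat) (q₁ q₂ : Q) (w : V r),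
      T q₂ (act q₁ r) (T q₁ r w) =
        c r q₁ q₂ • castHom V (hactmul q₁ q₂ r).symm
          (T (q₁ * q₂) r (ρ r ((tau j s hs q₁ q₂)⁻¹) w)))
    (hξ : ∀ r, ξ r (v r) = 1)
    (htriv : ∀ g : H, g ∈ j.ker → φ g = AlgEquiv.refl)
    (hD : ∀ a a' h h', D a (MonoidAlgebra.single h 1) * D a' (MonoidAlgebra.single h' 1) =
      D (a * φ h a') (MonoidAlgebra.single (h * h') 1))
    (hspan : ∀ b, ∃ β : H → A, b = ∑ h, D (β h) (MonoidAlgebra.single h 1))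
    (hfun : ∀ R : MonoidAlgebra ℂ H →ₗ[ℂ] ℂ, ∃ RA : B →ₗ[ℂ] A, ∀ a x, RA (D a x) = R x • a)
    [Ring (CrossQ Ghat Q A)] [Algebra ℂ (CrossQ Ghat Q A)]
    (hadd : ∀ F₁ F₂ : CrossQ Ghat Q A, (F₁ + F₂).coef = fun q r => F₁.coef q r + F₂.coef q r)
    (hsmul : ∀ (a : ℂ) (F : CrossQ Ghat Q A), (a • F).coef = fun q r => a • F.coef q r)
    (hmul : ∀ F₁ F₂ : CrossQ Ghat Q A, (F₁ * F₂).coef = fun q r =>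
      ∑ q₁ : Q, c r q₁ (q₁⁻¹ * q) •
        (F₁.coef q₁ r * (φ (s q₁)) (F₂.coef (q₁⁻¹ * q) (act q₁ r)))) :
    MoritaEquiv B (CrossQ Ghat Q A) := by
  classical
  let u : Q → Ghat → MonoidAlgebra ℂ H := crossUnit j s ρ T ξ v
  let ε : MonoidAlgebra ℂ H := kerIncl j (rankOneIdem j ρ ξ v)
  have hu (a a' : A) (q : Q) (r : Ghat) (y : MonoidAlgebra ℂ H) :
      D a (u q r) * D a' y = D (a * φ (s q) a') (u q r * y) :=
    apply_kerIncl_mul htriv hD a a' _ (s q) y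
  let iL : CrossQ Ghat Q A →ₗ[ℂ] B :=
    { toFun := fun F => ∑ q, ∑ r, D (F.coef q r) (u q r)
      map_add' := fun F G => by
        simp only [hadd, map_add, LinearMap.add_apply, Finset.sum_add_distrib]
      map_smul' := fun a F => by
        simp only [hsmul, map_smul, LinearMap.smul_apply, Finset.smul_sum, RingHom.id_apply] }
  have hi (F : CrossQ Ghat Q A) : iL F = ∑ q, ∑ r, D (F.coef q r) (u q r) := rfl
  have himul (F G : CrossQ Ghat Q A) : iL (F * G) = iL F * iL G := by
    have hprod (q₁ : Q) (r : Ghat) :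
        D (F.coef q₁ r) (u q₁ r) * iL G = ∑ q₂, D (c r q₁ q₂ •
          (F.coef q₁ r * φ (s q₁) (G.coef q₂ (act q₁ r)))) (u (q₁ * q₂) r) := by
      rw [hi, Finset.mul_sum]
      refine Finset.sum_congr rfl fun q₂ _ => ?_
      rw [Finset.mul_sum, Finset.sum_eq_single (act q₁ r)]
      · rw [hu, crossUnit_mul_crossUnit hirr hξ hs hactmul hT hcdef, map_smul, map_smul,
          LinearMap.smul_apply]
      · intro r' _ h
        rw [hu, crossUnit_mul_crossUnit_of_ne hirr hdist hT q₁ q₂ h, map_zero]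
      · simp
    rw [hi F, Finset.sum_mul]
    simp_rw [Finset.sum_mul, hprod]
    rw [hi]
    simp only [hmul, map_sum, LinearMap.sum_apply]
    rw [Finset.sum_comm, Finset.sum_comm (s := Finset.univ (α := Q)) (t := Finset.univ (α := Ghat))]
    refine Finset.sum_congr rfl fun r _ => ?_
    rw [Finset.sum_comm]
    refine Finset.sum_congr rfl fun q₁ _ => ?_
    rw [← Equiv.sum_comp (Equiv.mulLeft q₁)]
    simp
  let i : CrossQ Ghat Q A →ₙₐ[ℂ] B :=
    { toFun := iL
      map_smul' := map_smul iL
      map_zero' := map_zero iL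
      map_add' := map_add iL
      map_mul' := himul }
  have hinj : Function.Injective iL := by
    refine (injective_iff_map_eq_zero iL).2 fun F hF => ?_
    have hind := linearIndependent_crossUnit (T := T) hirr hdist hs hξ
    have hz (q : Q) (r : Ghat) : F.coef q r = 0 := by
      obtain ⟨R, hR⟩ := LinearMap.exists_extend (Finsupp.lapply (q, r) ∘ₗ hind.repr)
      have hRu (q' : Q) (r' : Ghat) : R (u q' r') = if (q', r') = (q, r) then 1 else 0 := by
        have hmem : u q' r' ∈ Submodule.span ℂ
            (Set.range fun p : Q × Ghat => crossUnit j s ρ T ξ v p.1 p.2) :=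
          Submodule.subset_span ⟨(q', r'), rfl⟩
        have := LinearMap.congr_fun hR ⟨_, hmem⟩
        rw [LinearMap.comp_apply, LinearMap.comp_apply,
          hind.repr_eq_single (q', r') ⟨_, hmem⟩ rfl] at this
        simpa [Finsupp.single_apply] using this
      obtain ⟨RA, hRA⟩ := hfun R
      have := congrArg RA hF
      rw [hi, map_zero] at this
      simpa [hRA, hRu, Prod.ext_iff, ite_and] using this
    have hc : F.coef = (0 : CrossQ Ghat Q A).coef := by
      have h0 : (0 : CrossQ Ghat Q A).coef = fun q r => 0 := by
        have := hsmul 0 0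
        rw [zero_smul] at this
        rw [this]
        simp
      rw [h0]
      exact funext fun q => funext fun r => hz q r
    cases F
    generalize (0 : CrossQ Ghat Q A) = Z at hc ⊢
    cases Z
    congr 1
  have hmem (a : A) (q : Q) (r : Ghat) : D a (u q r) ∈ LinearMap.range iL := by
    refine ⟨⟨Pi.single q (Pi.single r a)⟩, ?_⟩
    rw [hi, Finset.sum_eq_single q, Finset.sum_eq_single r]
    · simp
    · intro r' _ h
      simp [h]
    · simp
    · intro q' _ h
      simp [h]
    · simp
  have hrange' (b : B) : D 1 ε * b * D 1 ε ∈ LinearMap.range iL := by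
    obtain ⟨β, rfl⟩ := hspan b
    rw [Finset.mul_sum, Finset.sum_mul]
    refine Submodule.sum_mem _ fun h _ => ?_
    obtain ⟨κ, hκ⟩ := rankOneIdem_mul_single_mul_rankOneIdem (ξ := ξ) (v := v)
      hirr hdist hs hact hT h
    rw [mul_assoc, apply_single_mul hD, apply_kerIncl_mul' htriv hD, ← mul_assoc, hκ, map_sum]
    refine Submodule.sum_mem _ fun r _ => ?_
    rw [map_smul]
    exact Submodule.smul_mem _ _ (hmem _ _ _)
  have hεr (F : CrossQ Ghat Q A) : iL F * D 1 ε = iL F := by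
    rw [hi, Finset.sum_mul]
    refine Finset.sum_congr rfl fun q _ => ?_
    rw [Finset.sum_mul]
    refine Finset.sum_congr rfl fun r _ => (hu _ _ q r _).trans ?_
    rw [map_one, mul_one]
    exact congrArg _ (crossUnit_mul_rankOneIdem hirr hdist hξ hT q r)
  have hεε : D 1 ε * D 1 ε = D 1 ε :=
    (apply_one_mul hD ε ε).trans (congrArg (D 1) ((map_mul (kerIncl j) _ _).symm.trans
      (congrArg _ (rankOneIdem_mul_self hirr hdist hξ))))
  have hone : i 1 = D 1 ε := by
    obtain ⟨F, hF⟩ := hrange' 1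
    rw [mul_one, hεε] at hF
    change iL 1 = _
    rw [← hεr 1, ← hF, ← himul, one_mul]
  obtain ⟨x, y, hxy⟩ := exists_sum_mul_rankOneIdem_mul (ξ := ξ) (v := v) hirr hdist hcomplete hξ
  refine moritaEquiv_of_corner i (x := fun k => D 1 (kerIncl j (x k)))
    (y := fun k => D 1 (kerIncl j (y k))) hinj (fun b => ?_) ?_
  · rw [hone]
    exact hrange' b
  · simp_rw [hone, apply_one_mul hD, ε, ← map_mul]
    rw [← map_sum, ← map_sum, hxy, map_one (kerIncl j), apply_one_one hD hspan]

end CrossedProduct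

/-- **Proposition 3.10.** Let `A` be a unital ℂ-algebra with an `H`-action by
ℂ-algebra automorphisms `φ` such that `G = ker j` acts trivially (so `Q` acts via any lift).
Then the crossed product `A⋊H`, with product `(a₁⊗h₁)·(a₂⊗h₂) = a₁·h₁(a₂) ⊗ h₁h₂`, is Morita
equivalent to the twisted crossed product `Ã⋊_c Q`, with product
`(f₁⊗q₁)·(f₂⊗q₂) = ([ρ] ↦ c^{[ρ]}(q₁,q₂)·f₁([ρ])·q₁(f₂(q₁([ρ])))) ⊗ q₁q₂`.
(Each algebra is presented as any ℂ-algebra structure on the corresponding carrier whose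
addition, scalar multiplication and multiplication are the indicated convolutions.) -/
theorem stmt10 {H Q : Type} [Group H] [Group Q] [Fintype H] [Fintype Q]
    (j : H →* Q) (hj : Function.Surjective j)
    (s : Q → H) (hs : ∀ q, j (s q) = q) (hs1 : s 1 = 1)
    {Ghat : Type} [Fintype Ghat]
    (V : Ghat → Type) [∀ r, AddCommGroup (V r)] [∀ r, Module ℂ (V r)]
    [∀ r, FiniteDimensional ℂ (V r)]
    (ρ : ∀ r, Representation ℂ j.ker (V r))
    (hirr : ∀ r, IsIrredRep (ρ r))
    (hdist : ∀ r r', RepIso (ρ r) (ρ r') → r = r')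
    (hcomplete : ∀ (W : Type) [AddCommGroup W] [Module ℂ W] [FiniteDimensional ℂ W]
      (σ : Representation ℂ j.ker W), IsIrredRep σ → ∃ r, RepIso σ (ρ r))
    (act : Q → Ghat → Ghat)
    (hact : ∀ q r, RepIso (conjRep j (ρ r) (s q)) (ρ (act q r)))
    (hact1 : ∀ r, act 1 r = r)
    (hactmul : ∀ (q₁ q₂ : Q) (r : Ghat), act q₂ (act q₁ r) = act (q₁ * q₂) r)
    (T : ∀ (q : Q) (r : Ghat), V r ≃ₗ[ℂ] V (act q r))
    (hT : ∀ (q : Q) (r : Ghat) (g : j.ker) (v : V r),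
      T q r (conjRep j (ρ r) (s q) g v) = ρ (act q r) g (T q r v))
    (hT1 : ∀ (r : Ghat) (v : V r), T 1 r v = castHom V (hact1 r).symm v)
    (c : Ghat → Q → Q → ℂ)
    (hcdef : ∀ (r : Ghat) (q₁ q₂ : Q) (v : V r),
      T q₂ (act q₁ r) (T q₁ r v) =
        c r q₁ q₂ • castHom V (hactmul q₁ q₂ r).symm
          (T (q₁ * q₂) r (ρ r ((tau j s hs q₁ q₂)⁻¹) v)))
    -- the coefficient algebra `A` with its `H`-action, trivial on `G`
    (A : Type) [Ring A] [Algebra ℂ A]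
    (φ : H →* (A ≃ₐ[ℂ] A))
    (htriv : ∀ g : H, g ∈ j.ker → φ g = AlgEquiv.refl) :
    ∀ (instR₁ : Ring (CrossH H A)) (instA₁ : Algebra ℂ (CrossH H A))
      (instR₂ : Ring (CrossQ Ghat Q A)) (instA₂ : Algebra ℂ (CrossQ Ghat Q A)),
      (∀ f₁ f₂ : CrossH H A, (f₁ + f₂).coef = fun h => f₁.coef h + f₂.coef h) →
      (∀ (a : ℂ) (f : CrossH H A), (a • f).coef = fun h => a • f.coef h) →
      (∀ f₁ f₂ : CrossH H A, (f₁ * f₂).coef = fun h =>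
        ∑ h₁ : H, f₁.coef h₁ * (φ h₁) (f₂.coef (h₁⁻¹ * h))) →
      (∀ F₁ F₂ : CrossQ Ghat Q A, (F₁ + F₂).coef = fun q r => F₁.coef q r + F₂.coef q r) →
      (∀ (a : ℂ) (F : CrossQ Ghat Q A), (a • F).coef = fun q r => a • F.coef q r) →
      (∀ F₁ F₂ : CrossQ Ghat Q A, (F₁ * F₂).coef = fun q r =>
        ∑ q₁ : Q, c r q₁ (q₁⁻¹ * q) •
          (F₁.coef q₁ r * (φ (s q₁)) (F₂.coef (q₁⁻¹ * q) (act q₁ r)))) →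
      MoritaEquiv (CrossH H A) (CrossQ Ghat Q A) := by
  intro instR₁ instA₁ instR₂ instA₂ h1 h2 h3 h4 h5 h6
  have : Fintype j.ker := Fintype.ofFinite _
  have hex (r : Ghat) : ∃ (ξ : V r →ₗ[ℂ] ℂ) (v : V r), ξ v = 1 := by
    have := (hirr r).1
    let b := Module.finBasis ℂ (V r)
    exact ⟨b.coord ⟨0, Module.finrank_pos⟩, b ⟨0, Module.finrank_pos⟩, by simp⟩
  choose ξ v hξ using hex
  obtain ⟨D, hD, hspan, hfun⟩ := CrossH.exists_linearMap φ h1 h2 h3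
  have hbij (q : Q) : Function.Bijective (act q) :=
    Function.bijective_iff_has_inverse.2 ⟨act q⁻¹,
      fun r => by rw [hactmul, mul_inv_cancel, hact1],
      fun r => by rw [hactmul, inv_mul_cancel, hact1]⟩
  exact moritaEquiv_crossQ hs hirr hdist hcomplete hactmul hbij hT hcdef hξ htriv hD hspan hfun
    h4 h5 h6
end
end

section
/- Fix q ∈ Q, let ⟨q⟩ denote its conjugacy class in Q, let C_Q(q) be its centralizer, and let Ĝ^q := {[ρ] ∈ Ĝ : q([ρ]) = [ρ]}, on which C_Q(q) acts. Call a C_Q(q)-orbit O ⊆ Ĝ^q c-regular if there exists [ρ] ∈ O such that c^{[ρ]}(q₁,q) = c^{[ρ]}(q,q₁) for all q₁ in the stabilizer of [ρ] in C_Q(q). Then the number of conjugacy classes of H contained in j⁻¹(⟨q⟩) equals the number of c-regular C_Q(q)-orbits in Ĝ^q. -/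
noncomputable section

/-- The set `Ĝ^q` of (classes of) irreducible representations fixed by `q`. -/
def fixSet {Ghat Q : Type} (act : Q → Ghat → Ghat) (q : Q) : Set Ghat :=
  {r | act q r = r}

/-- The orbit equivalence relation of the action of a subgroup `C ≤ Q` on a subset `S ⊆ Ĝ`. -/
def orbitSetoid {Ghat Q : Type} [Group Q] (act : Q → Ghat → Ghat)
    (hact1 : ∀ r, act 1 r = r)
    (hactmul : ∀ (q₁ q₂ : Q) (r : Ghat), act q₂ (act q₁ r) = act (q₁ * q₂) r)
    (C : Subgroup Q) (S : Set Ghat) : Setoid S where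
  r x y := ∃ u ∈ C, act u x.1 = y.1
  iseqv := by
    constructor
    · exact fun x => ⟨1, C.one_mem, hact1 x.1⟩
    · rintro x y ⟨u, hu, hxy⟩
      exact ⟨u⁻¹, C.inv_mem hu, by rw [← hxy, hactmul, mul_inv_cancel, hact1]⟩
    · rintro x y z ⟨u, hu, hxy⟩ ⟨u', hu', hyz⟩
      exact ⟨u * u', C.mul_mem hu hu', by rw [← hactmul, hxy]; exact hyz⟩

section Schur

variable {K V W : Type} [Group K] [AddCommGroup V] [Module ℂ V] [AddCommGroup W] [Module ℂ W]

theorem IsIrredRep.eq_zero_or_bijective {ρ : Representation ℂ K V} {σ : Representation ℂ K W}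
    (hρ : IsIrredRep ρ) (hσ : IsIrredRep σ) (f : V →ₗ[ℂ] W)
    (hf : ∀ k v, f (ρ k v) = σ k (f v)) : f = 0 ∨ Function.Bijective f := by
  rcases hρ.2 (LinearMap.ker f) (fun k v hv => by
    rw [LinearMap.mem_ker] at hv ⊢; rw [hf, hv, map_zero]) with hk | hk
  · rcases hσ.2 (LinearMap.range f) (by
      rintro k _ ⟨v, rfl⟩; exact ⟨ρ k v, hf k v⟩) with hr | hr
    · exact Or.inl (LinearMap.range_eq_bot.mp hr)
    · exact Or.inr ⟨LinearMap.ker_eq_bot.mp hk, LinearMap.range_eq_top.mp hr⟩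
  · exact Or.inl (LinearMap.ker_eq_top.mp hk)

theorem IsIrredRep.exists_smul [FiniteDimensional ℂ V] {ρ : Representation ℂ K V}
    (hρ : IsIrredRep ρ) (f : V →ₗ[ℂ] V) (hf : ∀ k v, f (ρ k v) = ρ k (f v)) :
    ∃ t : ℂ, ∀ v, f v = t • v := by
  have := hρ.1
  obtain ⟨t, ht⟩ := Module.End.exists_eigenvalue f
  refine ⟨t, ?_⟩
  rcases hρ.2 (Module.End.eigenspace f t) (fun k v hv => by
    rw [Module.End.mem_eigenspace_iff] at hv ⊢; rw [hf, hv, map_smul]) with h | h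
  · exact absurd h ht
  · intro v
    exact Module.End.mem_eigenspace_iff.mp (h ▸ Submodule.mem_top : v ∈ Module.End.eigenspace f t)

theorem RepIso.symm {ρ : Representation ℂ K V} {σ : Representation ℂ K W} (h : RepIso ρ σ) :
    RepIso σ ρ := by
  obtain ⟨e, he⟩ := h
  exact ⟨e.symm, fun k v => by rw [LinearEquiv.symm_apply_eq, he, e.apply_symm_apply]⟩

theorem RepIso.trans {U : Type} [AddCommGroup U] [Module ℂ U] {ρ : Representation ℂ K V}
    {σ : Representation ℂ K W} {τ : Representation ℂ K U} (h : RepIso ρ σ) (h' : RepIso σ τ) :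
    RepIso ρ τ := by
  obtain ⟨e, he⟩ := h
  obtain ⟨e', he'⟩ := h'
  exact ⟨e.trans e', fun k v => by simp [he, he']⟩

end Schur

section Fourier

open scoped MonoidAlgebra

variable {K ι : Type} [Group K] [Fintype K] (V : ι → Type)
  [∀ r, AddCommGroup (V r)] [∀ r, Module ℂ (V r)] (ρ : ∀ r, Representation ℂ K (V r))

/-- The Fourier coefficient at `r` of a function on a finite group. -/
def groupFourier (r : ι) : (K → ℂ) →ₗ[ℂ] Module.End ℂ (V r) :=
  Fintype.linearCombination ℂ (fun g => ρ r g)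

theorem groupFourier_apply (r : ι) (a : K → ℂ) (v : V r) :
    groupFourier V ρ r a v = ∑ g, a g • ρ r g v := by
  simp [groupFourier, Fintype.linearCombination_apply, LinearMap.sum_apply]

theorem asAlgebraHom_eq_groupFourier (r : ι) (a : ℂ[K]) :
    (ρ r).asAlgebraHom a = groupFourier V ρ r a.coeff := by
  induction a using MonoidAlgebra.induction_linear with
  | zero => simp
  | add f g hf hg => simp [hf, hg]
  | single g t =>
    classical
    simp [groupFourier, Fintype.linearCombination_apply, Finsupp.single_apply, ite_smul]

theorem groupFourier_injective
    (hcomplete : ∀ (W : Type) [AddCommGroup W] [Module ℂ W] [FiniteDimensional ℂ W]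
      (σ : Representation ℂ K W), IsIrredRep σ → ∃ r, RepIso σ (ρ r))
    (a : K → ℂ) (ha : ∀ r, groupFourier V ρ r a = 0) : a = 0 := by
  let b : ℂ[K] := MonoidAlgebra.ofCoeff (Finsupp.equivFunOnFinite.symm a)
  have hb : ∀ r, (ρ r).asAlgebraHom b = 0 := fun r => by
    rw [asAlgebraHom_eq_groupFourier]; exact ha r
  have hmem : b ∈ Ring.jacobson ℂ[K] := by
    refine Submodule.mem_sInf.mpr fun I hI => ?_
    have : IsSimpleModule ℂ[K] (ℂ[K] ⧸ I) := isSimpleModule_iff_isCoatom.mpr hI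
    let σ : Representation ℂ K (ℂ[K] ⧸ I) := Representation.ofModule' (ℂ[K] ⧸ I)
    have hσ : ∀ (c : ℂ[K]) (v : ℂ[K] ⧸ I), σ.asAlgebraHom c v = c • v := by
      intro c v
      have : σ.asAlgebraHom = Algebra.lsmul ℂ ℂ (ℂ[K] ⧸ I) :=
        (MonoidAlgebra.lift ℂ (Module.End ℂ (ℂ[K] ⧸ I)) K).apply_symm_apply _
      rw [this]; rfl
    have hσ' : ∀ (k : K) (v : ℂ[K] ⧸ I), σ k v = MonoidAlgebra.single k (1 : ℂ) • v := by
      intro k v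
      rw [← hσ, Representation.asAlgebraHom_single_one]
    have : FiniteDimensional ℂ ℂ[K] :=
      Module.Finite.equiv (MonoidAlgebra.coeffLinearEquiv ℂ).symm
    have : FiniteDimensional ℂ (ℂ[K] ⧸ I) :=
      Module.Finite.of_surjective ((Submodule.mkQ I).restrictScalars ℂ) (Submodule.mkQ_surjective I)
    obtain ⟨r, e, he⟩ := hcomplete (ℂ[K] ⧸ I) σ ⟨IsSimpleModule.nontrivial ℂ[K] _, by
      intro W hW
      let W' : Submodule ℂ[K] (ℂ[K] ⧸ I) :=
        { W with
          smul_mem' := by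
            intro c v hv
            induction c using MonoidAlgebra.induction_linear with
            | zero => rw [zero_smul]; exact W.zero_mem
            | add f g hf hg => rw [add_smul]; exact W.add_mem hf hg
            | single g t =>
              have : MonoidAlgebra.single g t = t • MonoidAlgebra.single g (1 : ℂ) := by simp
              rw [this, smul_assoc, ← hσ']
              exact W.smul_mem _ (hW g v hv) }
      rcases eq_bot_or_eq_top W' with h | h
      · left
        exact SetLike.ext fun v => (SetLike.ext_iff.mp h v)
      · right
        exact SetLike.ext fun v => (SetLike.ext_iff.mp h v)⟩
    have he' : ∀ (c : ℂ[K]) v, e (σ.asAlgebraHom c v) = (ρ r).asAlgebraHom c (e v) := by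
      intro c v
      induction c using MonoidAlgebra.induction_linear with
      | zero => simp
      | add f g hf hg => simp only [map_add, LinearMap.add_apply, hf, hg]
      | single g t => simp [he]
    have := he' b (Submodule.Quotient.mk 1)
    rw [hb, LinearMap.zero_apply, LinearEquiv.map_eq_zero_iff, hσ, ← Submodule.Quotient.mk_smul,
      smul_eq_mul, mul_one, Submodule.Quotient.mk_eq_zero] at this
    exact this
  rw [IsSemisimpleRing.jacobson_eq_bot, Submodule.mem_bot] at hmem
  have := congrArg MonoidAlgebra.coeff hmem
  funext g
  exact DFunLike.congr_fun this g

theorem groupFourier_surjective [Fintype ι] [∀ r, FiniteDimensional ℂ (V r)]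
    (hirr : ∀ r, IsIrredRep (ρ r)) (hdist : ∀ r r', RepIso (ρ r) (ρ r') → r = r')
    (B : ∀ r, Module.End ℂ (V r)) : ∃ a : K → ℂ, ∀ r, groupFourier V ρ r a = B r := by
  classical
  let M := ∀ r, (ρ r).asModule
  let E := Module.End ℂ[K] M
  let ins : ∀ r, V r →+ M := fun r =>
    (AddMonoidHom.single (fun r => (ρ r).asModule) r).comp
      (ρ r).asModuleEquiv.symm.toAddEquiv.toAddMonoidHom
  have hins : ∀ r (b : ℂ[K]) (v : V r), ins r ((ρ r).asAlgebraHom b v) = b • ins r v :=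
    fun r b v => Pi.single_smul (f := fun r => (ρ r).asModule) r b ((ρ r).asModuleEquiv.symm v)
  have hscalar : ∀ φ : E, ∃ t : ι → ℂ, ∀ m r, φ m r = t r • m r := by
    intro φ
    have hφ : ∀ (r r' : ι) (b : ℂ[K]) (v : V r'),
        φ (ins r' ((ρ r').asAlgebraHom b v)) r = (ρ r).asAlgebraHom b (φ (ins r' v) r) := by
      intro r r' b v
      rw [hins, map_smul]; rfl
    let comp : ∀ r r' : ι, V r' →ₗ[ℂ] V r := fun r r' =>
      { toFun := fun v => φ (ins r' v) r
        map_add' := fun v w => by rw [map_add, map_add]; rfl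
        map_smul' := fun t v => by
          have := hφ r r' (MonoidAlgebra.single 1 t) v
          rwa [Representation.asAlgebraHom_single, Representation.asAlgebraHom_single, map_one,
            map_one] at this }
    have hcomm : ∀ (r r' : ι) (k : K) (v : V r'), comp r r' (ρ r' k v) = ρ r k (comp r r' v) := by
      intro r r' k v
      have := hφ r r' (MonoidAlgebra.single k 1) v
      rwa [Representation.asAlgebraHom_single_one, Representation.asAlgebraHom_single_one] at this
    have hoff : ∀ r r', r' ≠ r → comp r r' = 0 := by
      intro r r' hne
      refine ((hirr r').eq_zero_or_bijective (hirr r) _ (hcomm r r')).resolve_right fun hb => ?_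
      exact hne (hdist _ _ ⟨LinearEquiv.ofBijective _ hb, hcomm r r'⟩)
    choose t ht using fun r => (hirr r).exists_smul (comp r r) (hcomm r r)
    refine ⟨t, fun m r => ?_⟩
    conv_lhs => rw [← Finset.univ_sum_single m, map_sum, Finset.sum_apply]
    rw [Finset.sum_eq_single r]
    · exact ht r (m r)
    · intro r' _ hne
      exact LinearMap.congr_fun (hoff r r' hne) (m r')
    · simp
  let f : Module.End E M :=
    { toFun := fun m r => B r (m r)
      map_add' := fun m m' => funext fun r => map_add (B r) _ _
      map_smul' := fun φ m => by
        obtain ⟨t, ht⟩ := hscalar φ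
        funext r
        refine (congrArg (B r) (ht m r)).trans (Eq.trans ?_ (ht (fun r => B r (m r)) r).symm)
        exact map_smul (B r) (t r) (m r) }
  let bas := fun r => Module.finBasis ℂ (V r)
  obtain ⟨b, hb⟩ := jacobson_density f
    (Finset.univ.image fun x : (Σ r, Fin (Module.finrank ℂ (V r))) => ins x.1 (bas x.1 x.2))
  refine ⟨b.coeff, fun r => (bas r).ext fun i => ?_⟩
  have h := congrFun (hb _ (Finset.mem_image_of_mem _ (Finset.mem_univ ⟨r, i⟩))) r
  have hself : ∀ v, ins r v r = v := fun v => Pi.single_eq_same (M := fun r => (ρ r).asModule) r v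
  rw [← asAlgebraHom_eq_groupFourier]
  rw [← hins] at h
  exact ((hself _).symm.trans h.symm).trans (congrArg (B r) (hself _))

end Fourier

section TwistedConj

variable {H Q : Type} [Group H] [Group Q] (j : H →* Q) {q : Q} {x : H} (hx : j x = q)

/-- The preimage under `j` of the centralizer of `q`. -/
abbrev centralizerPreimage (q : Q) : Subgroup H := (Subgroup.centralizer ({q} : Set Q)).comap j

/-- The element `x⁻¹ y x y⁻¹` of the kernel, for `j y` centralizing `j x`. -/
def kerCommutator (y : centralizerPreimage j q) : j.ker :=
  ⟨x⁻¹ * y * x * (y : H)⁻¹, by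
    have hy : j y * q = q * j y :=
      Subgroup.mem_centralizer_singleton_iff.mp (Subgroup.mem_comap.mp y.2)
    rw [MonoidHom.mem_ker, map_mul, map_mul, map_mul, map_inv, map_inv, hx, mul_assoc q⁻¹, hy]
    group⟩

theorem kerCommutator_mul (y z : centralizerPreimage j q) :
    kerCommutator j hx (y * z) =
      kerCommutator j hx y * MulAut.conjNormal (y : H) (kerCommutator j hx z) := by
  ext
  simp only [kerCommutator, Subgroup.coe_mul, MulAut.conjNormal_apply]
  group

/-- The action of `y` on functions on the coset `x * ker j` by conjugation, this coset being
identified with `ker j`. -/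
def conjTranslate (y : centralizerPreimage j q) : (j.ker → ℂ) →ₗ[ℂ] (j.ker → ℂ) :=
  LinearMap.funLeft ℂ ℂ (fun g => kerCommutator j hx y * MulAut.conjNormal (y : H) g)

theorem conjTranslate_apply (y : centralizerPreimage j q) (a : j.ker → ℂ) (g : j.ker) :
    conjTranslate j hx y a g = a (kerCommutator j hx y * MulAut.conjNormal (y : H) g) := rfl

theorem conjTranslate_conjTranslate (y z : centralizerPreimage j q) (a : j.ker → ℂ) :
    conjTranslate j hx z (conjTranslate j hx y a) = conjTranslate j hx (y * z) a := by
  funext g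
  simp only [conjTranslate_apply, kerCommutator_mul, map_mul, Subgroup.coe_mul, MulAut.mul_apply,
    mul_assoc]

/-- The functions on the coset `x * ker j` (identified with `ker j`) which are constant on
conjugacy classes of `H`. -/
def twistedClassFunctions : Submodule ℂ (j.ker → ℂ) where
  carrier := {a | ∀ y, conjTranslate j hx y a = a}
  add_mem' ha hb y := by rw [map_add, ha, hb]
  zero_mem' y := map_zero _
  smul_mem' t a ha y := by rw [map_smul, ha]

theorem isConj_coset_iff (g g' : j.ker) :
    IsConj (x * g) (x * g') ↔ ∃ y : centralizerPreimage j q,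
      g' = kerCommutator j hx y * MulAut.conjNormal (y : H) g := by
  rw [isConj_iff]
  constructor
  · rintro ⟨y, hy⟩
    have hyc : y ∈ centralizerPreimage j q := by
      rw [Subgroup.mem_comap, Subgroup.mem_centralizer_singleton_iff]
      have := congrArg j hy
      simp only [map_mul, map_inv, hx, (MonoidHom.mem_ker).mp g.2, (MonoidHom.mem_ker).mp g'.2,
        mul_one] at this
      exact mul_inv_eq_iff_eq_mul.mp this
    refine ⟨⟨y, hyc⟩, Subtype.ext ?_⟩
    simp only [kerCommutator, Subgroup.coe_mul, MulAut.conjNormal_apply]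
    rw [← mul_right_inj x, ← hy]
    group
  · rintro ⟨y, rfl⟩
    refine ⟨y, ?_⟩
    simp only [kerCommutator, Subgroup.coe_mul, MulAut.conjNormal_apply]
    group

theorem finrank_twistedClassFunctions [Finite H] (hj : Function.Surjective j) :
    Module.finrank ℂ (twistedClassFunctions j hx) =
      Nat.card {γ : ConjClasses H // ∃ h : H, γ = ConjClasses.mk h ∧ IsConj q (j h)} := by
  let π : j.ker → {γ : ConjClasses H // ∃ h : H, γ = ConjClasses.mk h ∧ IsConj q (j h)} :=
    fun g => ⟨ConjClasses.mk (x * g), x * g, rfl, by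
      rw [map_mul, hx, (MonoidHom.mem_ker).mp g.2, mul_one]⟩
  have hπ : ∀ g g', π g = π g' ↔ ∃ y : centralizerPreimage j q,
      g' = kerCommutator j hx y * MulAut.conjNormal (y : H) g := by
    intro g g'
    rw [← isConj_coset_iff, Subtype.mk_eq_mk, ConjClasses.mk_eq_mk_iff_isConj]
  have hsurj : Function.Surjective π := by
    rintro ⟨_, h, rfl, hh⟩
    obtain ⟨c, hc⟩ := isConj_iff.mp hh
    obtain ⟨z, rfl⟩ := hj c
    refine ⟨⟨x⁻¹ * (z⁻¹ * h * z), ?_⟩, Subtype.ext ?_⟩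
    · rw [MonoidHom.mem_ker]
      simp only [map_mul, map_inv, ← hc, hx]
      group
    · refine ConjClasses.mk_eq_mk_iff_isConj.mpr (isConj_iff.mpr ⟨z, ?_⟩)
      group
  have hrange : LinearMap.range (LinearMap.funLeft ℂ ℂ π) = twistedClassFunctions j hx := by
    ext a
    constructor
    · rintro ⟨b, rfl⟩ y
      funext g
      exact congrArg b ((hπ _ _).mpr ⟨y, rfl⟩).symm
    · intro ha
      refine ⟨fun γ => a (Function.surjInv hsurj γ), funext fun g => ?_⟩
      obtain ⟨y, hy⟩ := (hπ _ _).mp (Function.surjInv_eq hsurj (π g)).symm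
      exact (congrArg a hy).trans (congrFun (ha y) g)
  have := Fintype.ofFinite {γ : ConjClasses H // ∃ h : H, γ = ConjClasses.mk h ∧ IsConj q (j h)}
  rw [← hrange,
    LinearMap.finrank_range_of_inj (LinearMap.funLeft_injective_of_surjective ℂ ℂ π hsurj),
    Module.finrank_fintype_fun_eq_card, Nat.card_eq_fintype_card]

theorem sum_conjTranslate_mem [Fintype (centralizerPreimage j q)] (a : j.ker → ℂ) :
    ∑ y, conjTranslate j hx y a ∈ twistedClassFunctions j hx := by
  intro z
  rw [map_sum]
  simp only [conjTranslate_conjTranslate]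
  exact Fintype.sum_equiv (Equiv.mulRight z) _ _ fun y => rfl

/-- `A` is an intertwining map from the conjugate of the first representation by `y` to the second. -/
def IsTwisted {V W : Type} [AddCommGroup V] [Module ℂ V] [AddCommGroup W] [Module ℂ W]
    (σ : Representation ℂ j.ker V) (σ' : Representation ℂ j.ker W) (y : H) (A : V →ₗ[ℂ] W) :
    Prop :=
  ∀ (k : j.ker) (v : V), A (σ (MulAut.conjNormal y k) v) = σ' k (A v)

theorem groupFourier_conjTranslate [Fintype j.ker] {ι : Type} (V : ι → Type)
    [∀ r, AddCommGroup (V r)] [∀ r, Module ℂ (V r)] (ρ : ∀ r, Representation ℂ j.ker (V r))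
    {r r' : ι} (y : centralizerPreimage j q) (A : V r →ₗ[ℂ] V r')
    (hA : IsTwisted j (ρ r) (ρ r') (y : H) A) (a : j.ker → ℂ) (v : V r) :
    groupFourier V ρ r' (conjTranslate j hx y a) (A v) =
      A (ρ r (kerCommutator j hx y)⁻¹ (groupFourier V ρ r a v)) := by
  simp only [groupFourier_apply, map_sum, map_smul]
  refine Fintype.sum_equiv ((MulAut.conjNormal (y : H)).toEquiv.trans
    (Equiv.mulLeft (kerCommutator j hx y))) _ _ fun g => ?_
  rw [← hA, conjTranslate_apply, ← Module.End.mul_apply, ← map_mul]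
  simp

end TwistedConj

section IsTwisted

variable {H Q : Type} [Group H] [Group Q] (j : H →* Q) {V W : Type} [AddCommGroup V] [Module ℂ V]
  [AddCommGroup W] [Module ℂ W] {σ : Representation ℂ j.ker V} {σ' : Representation ℂ j.ker W}

theorem IsIrredRep.conjRep (hσ : IsIrredRep σ) (y : H) : IsIrredRep (conjRep j σ y) := by
  refine ⟨hσ.1, fun U hU => hσ.2 U fun k v hv => ?_⟩
  have := hU ((MulAut.conjNormal y).symm k) v hv
  rwa [_root_.conjRep, MonoidHom.comp_apply, MulEquiv.coe_toMonoidHom,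
    MulEquiv.apply_symm_apply] at this

variable {j}

theorem IsTwisted.eq_zero_or_bijective {y : H} {A : V →ₗ[ℂ] W} (hA : IsTwisted j σ σ' y A)
    (hσ : IsIrredRep σ) (hσ' : IsIrredRep σ') : A = 0 ∨ Function.Bijective A :=
  (hσ.conjRep j y).eq_zero_or_bijective hσ' A hA

theorem IsTwisted.exists_smul [FiniteDimensional ℂ W] {y : H} {A : V ≃ₗ[ℂ] W} {B : V →ₗ[ℂ] W}
    (hA : IsTwisted j σ σ' y A) (hB : IsTwisted j σ σ' y B) (hσ' : IsIrredRep σ') :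
    ∃ t : ℂ, ∀ v, B v = t • A v := by
  obtain ⟨t, ht⟩ := hσ'.exists_smul (B ∘ₗ A.symm.toLinearMap) fun k w => by
    obtain ⟨v, rfl⟩ := A.surjective w
    have := hA k v
    simp only [LinearEquiv.coe_coe] at this
    simp only [LinearMap.comp_apply, LinearEquiv.coe_coe, ← this, LinearEquiv.symm_apply_apply]
    exact hB k v
  exact ⟨t, fun v => by simpa using ht (A v)⟩

theorem IsTwisted.mul_ker {y y' : H} (g : j.ker) (hy : y' = y * g) {A : V →ₗ[ℂ] W}
    (hA : IsTwisted j σ σ' y A) : IsTwisted j σ σ' y' (σ' g⁻¹ ∘ₗ A) := by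
  intro k v
  have h : MulAut.conjNormal y' k = MulAut.conjNormal y (g * k * g⁻¹) := by
    ext
    simp only [hy, MulAut.conjNormal_apply, Subgroup.coe_mul, InvMemClass.coe_inv]
    group
  rw [h, LinearMap.comp_apply, hA, LinearMap.comp_apply, ← Module.End.mul_apply,
    ← Module.End.mul_apply, ← map_mul, ← map_mul,
    show g⁻¹ * (g * k * g⁻¹) = k * g⁻¹ by group]

theorem isTwisted_ker (g : j.ker) : IsTwisted j σ σ (g : H) (σ g⁻¹) := by
  intro k v
  have h : MulAut.conjNormal (g : H) k = g * k * g⁻¹ := by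
    ext
    simp [MulAut.conjNormal_apply]
  rw [h, ← Module.End.mul_apply, ← Module.End.mul_apply, ← map_mul, ← map_mul]
  congr 2
  group

variable {q : Q} {x : H} (hx : j x = q)

theorem IsTwisted.comm_mul_ker {σ : Representation ℂ j.ker V} {S A : V →ₗ[ℂ] V}
    (hS : IsTwisted j σ σ x S) {y y' : centralizerPreimage j q} (g : j.ker)
    (hy : (y' : H) = y * g) (hA : IsTwisted j σ σ (y : H) A)
    (hcomm : ∀ v, S (A v) = A (σ (kerCommutator j hx y)⁻¹ (S v))) (v : V) :
    S (σ g⁻¹ (A v)) = σ g⁻¹ (A (σ (kerCommutator j hx y')⁻¹ (S v))) := by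
  have h : g⁻¹ = MulAut.conjNormal x (MulAut.conjNormal x⁻¹ g⁻¹) := by
    rw [← MulAut.mul_apply, ← map_mul, mul_inv_cancel, map_one, MulAut.one_apply]
  conv_lhs => rw [h]
  rw [hS, hcomm, ← hA, ← hA, ← Module.End.mul_apply (σ _) (σ _), ← map_mul,
    ← Module.End.mul_apply (σ _) (σ _), ← map_mul]
  congr 3
  ext
  simp only [kerCommutator, hy, MulAut.conjNormal_apply, Subgroup.coe_mul, InvMemClass.coe_inv]
  group

theorem isTwisted_groupFourier [Fintype j.ker] {ι : Type} (V : ι → Type)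
    [∀ r, AddCommGroup (V r)] [∀ r, Module ℂ (V r)] (ρ : ∀ r, Representation ℂ j.ker (V r))
    {a : j.ker → ℂ} (ha : a ∈ twistedClassFunctions j hx) (r : ι) :
    IsTwisted j (ρ r) (ρ r) x (groupFourier V ρ r a) := by
  intro k v
  let g : j.ker := (MulAut.conjNormal x k)⁻¹
  let y : centralizerPreimage j q := ⟨g, by
    rw [Subgroup.mem_comap, (MonoidHom.mem_ker).mp g.2]; exact one_mem _⟩
  have h := groupFourier_conjTranslate j hx V ρ y (ρ r g⁻¹) (isTwisted_ker g) a v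
  rw [ha y, inv_inv, ← Module.End.mul_apply (ρ r _), ← map_mul] at h
  rw [h]
  congr 3
  ext
  simp only [kerCommutator, y, g, MulAut.conjNormal_apply, Subgroup.coe_mul, InvMemClass.coe_inv]
  group

end IsTwisted

section Count

variable {H Q : Type} [Group H] [Group Q] {j : H →* Q} {q : Q} {x : H} (hx : j x = q)
  {Ghat : Type} (V : Ghat → Type) [∀ r, AddCommGroup (V r)] [∀ r, Module ℂ (V r)]
  (ρ : ∀ r, Representation ℂ j.ker (V r))

/-- Some `x`-twisted automorphism of `V r` is compatible with all twisted automorphisms coming from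
the preimage of the centralizer of `q = j x`. -/
def IsTwistRegular (r : Ghat) : Prop :=
  ∃ S : V r ≃ₗ[ℂ] V r, IsTwisted j (ρ r) (ρ r) x S ∧
    ∀ (y : centralizerPreimage j q) (A : V r ≃ₗ[ℂ] V r), IsTwisted j (ρ r) (ρ r) (y : H) A →
      ∀ v, S (A v) = A (ρ r (kerCommutator j hx y)⁻¹ (S v))

variable [Fintype H] [Fintype Ghat] [∀ r, FiniteDimensional ℂ (V r)]
  (hirr : ∀ r, IsIrredRep (ρ r)) (hdist : ∀ r r', RepIso (ρ r) (ρ r') → r = r')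
  (act : Q → Ghat → Ghat) (hact1 : ∀ r, act 1 r = r)
  (hactmul : ∀ (q₁ q₂ : Q) (r : Ghat), act q₂ (act q₁ r) = act (q₁ * q₂) r)
  (htwist : ∀ (y : H) (r : Ghat), ∃ A : V r ≃ₗ[ℂ] V (act (j y) r),
    IsTwisted j (ρ r) (ρ (act (j y) r)) y A)

include hdist htwist in
omit [Fintype H] [Fintype Ghat] [∀ r, FiniteDimensional ℂ (V r)] in
theorem act_eq_of_isTwisted {y : H} {r r' : Ghat} {A : V r ≃ₗ[ℂ] V r'}
    (hA : IsTwisted j (ρ r) (ρ r') y A) : act (j y) r = r' := by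
  obtain ⟨A', hA'⟩ := htwist y r
  exact hdist _ _ (RepIso.trans (RepIso.symm (ρ := conjRep j (ρ r) y) ⟨A', hA'⟩) ⟨A, hA⟩)

include hirr hdist hact1 hactmul htwist in
theorem exists_twistedClassFunction [Fintype j.ker] {r₀ : Ghat} (S : V r₀ ≃ₗ[ℂ] V r₀)
    (hcomm : ∀ (y : centralizerPreimage j q) (A : V r₀ ≃ₗ[ℂ] V r₀),
      IsTwisted j (ρ r₀) (ρ r₀) (y : H) A →
        ∀ v, S (A v) = A (ρ r₀ (kerCommutator j hx y)⁻¹ (S v))) :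
    ∃ a ∈ twistedClassFunctions j hx, groupFourier V ρ r₀ a = S ∧
      ∀ r, (∀ u ∈ Subgroup.centralizer ({q} : Set Q), act u r₀ ≠ r) →
        groupFourier V ρ r a = 0 := by
  classical
  obtain ⟨a, ha⟩ := groupFourier_surjective V ρ hirr hdist (Pi.single r₀ (S : V r₀ →ₗ[ℂ] V r₀))
  have hcoeff : ∀ (y : centralizerPreimage j q) (r : Ghat),
      (act (j y) r₀ ≠ r → groupFourier V ρ r (conjTranslate j hx y a) = 0) ∧
      (act (j y) r₀ = r₀ → groupFourier V ρ r₀ (conjTranslate j hx y a) = S) := by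
    intro y r
    constructor
    · intro hne
      obtain ⟨r', rfl⟩ : ∃ r', act (j y) r' = r :=
        ⟨act (j y)⁻¹ r, by rw [hactmul, inv_mul_cancel, hact1]⟩
      obtain ⟨A, hA⟩ := htwist y r'
      refine LinearMap.ext fun w => ?_
      obtain ⟨v, rfl⟩ := A.surjective w
      have h := groupFourier_conjTranslate j hx V ρ y A.toLinearMap hA a v
      rw [ha r', Pi.single_eq_of_ne (fun h => hne (by rw [h]))] at h
      simpa using h
    · intro heq
      obtain ⟨A, hA⟩ : ∃ A : V r₀ ≃ₗ[ℂ] V r₀, IsTwisted j (ρ r₀) (ρ r₀) (y : H) A := by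
        have := htwist y r₀
        rwa [heq] at this
      refine LinearMap.ext fun w => ?_
      obtain ⟨v, rfl⟩ := A.surjective w
      have h := groupFourier_conjTranslate j hx V ρ y A.toLinearMap hA a v
      rw [ha r₀, Pi.single_eq_same] at h
      exact h.trans (hcomm y A hA v).symm
  let stab := Finset.univ.filter fun y : centralizerPreimage j q => act (j y) r₀ = r₀
  have hstab : (stab.card : ℂ) ≠ 0 := by
    rw [Nat.cast_ne_zero, Finset.card_ne_zero]
    exact ⟨1, by simp [stab, hact1]⟩
  refine ⟨(stab.card : ℂ)⁻¹ • ∑ y, conjTranslate j hx y a,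
    Submodule.smul_mem _ _ (sum_conjTranslate_mem j hx a), ?_, fun r hr => ?_⟩
  · have : ∀ y, groupFourier V ρ r₀ (conjTranslate j hx y a) =
        if act (j y) r₀ = r₀ then (S : V r₀ →ₗ[ℂ] V r₀) else 0 := fun y => by
      split_ifs with h
      · exact (hcoeff y r₀).2 h
      · exact (hcoeff y r₀).1 h
    rw [map_smul, map_sum, Finset.sum_congr rfl fun y _ => this y, ← Finset.sum_filter,
      Finset.sum_const, ← Nat.cast_smul_eq_nsmul ℂ, smul_smul, inv_mul_cancel₀ hstab, one_smul]
  · rw [map_smul, map_sum, Finset.sum_eq_zero fun y _ => (hcoeff y r).1 (hr _ y.2), smul_zero]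

include hirr hdist hact1 hactmul htwist in
theorem finrank_twistedClassFunctions_eq_card_orbits
    (hj : Function.Surjective j)
    (hcomplete : ∀ (W : Type) [AddCommGroup W] [Module ℂ W] [FiniteDimensional ℂ W]
      (σ : Representation ℂ j.ker W), IsIrredRep σ → ∃ r, RepIso σ (ρ r)) :
    Module.finrank ℂ (twistedClassFunctions j hx) =
      Nat.card {O : Quotient (orbitSetoid act hact1 hactmul
            (Subgroup.centralizer ({q} : Set Q)) (fixSet act q)) //
          ∃ r : fixSet act q,
            Quotient.mk (orbitSetoid act hact1 hactmul
                (Subgroup.centralizer ({q} : Set Q)) (fixSet act q)) r = O ∧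
            IsTwistRegular hx V ρ r.1} := by
  classical
  have := Fintype.ofFinite j.ker
  set RegOrbit := {O : Quotient (orbitSetoid act hact1 hactmul
            (Subgroup.centralizer ({q} : Set Q)) (fixSet act q)) //
          ∃ r : fixSet act q,
            Quotient.mk (orbitSetoid act hact1 hactmul
                (Subgroup.centralizer ({q} : Set Q)) (fixSet act q)) r = O ∧
            IsTwistRegular hx V ρ r.1}
  have : Fintype RegOrbit := Fintype.ofFinite _
  choose rep hrep hreg using fun O : RegOrbit => O.2
  choose S hS hcomm using hreg
  have hdual : ∀ O, ∃ φ : Module.Dual ℂ (Module.End ℂ (V (rep O).1)), φ (S O) = 1 := by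
    intro O
    have hne : (S O : Module.End ℂ (V (rep O).1)) ≠ 0 := by
      intro h
      have := (hirr (rep O).1).1
      obtain ⟨v, hv⟩ := exists_ne (0 : V (rep O).1)
      exact hv ((S O).map_eq_zero_iff.mp (LinearMap.congr_fun h v))
    obtain ⟨φ, hφ⟩ := not_forall.mp (mt (Module.forall_dual_apply_eq_zero_iff ℂ _).mp hne)
    exact ⟨(φ (S O))⁻¹ • φ, by simp [inv_mul_cancel₀ hφ]⟩
  choose φ hφ using hdual
  let ev : twistedClassFunctions j hx →ₗ[ℂ] (RegOrbit → ℂ) :=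
    LinearMap.pi fun O => (φ O ∘ₗ groupFourier V ρ (rep O).1) ∘ₗ Submodule.subtype _
  have hinj : Function.Injective ev := by
    rw [injective_iff_map_eq_zero]
    rintro ⟨a, ha⟩ hev
    refine Subtype.ext (groupFourier_injective V ρ hcomplete a fun r => ?_)
    by_contra hne
    have hbij := ((isTwisted_groupFourier hx V ρ ha r).eq_zero_or_bijective
      (hirr r) (hirr r)).resolve_left hne
    let F := LinearEquiv.ofBijective _ hbij
    have hF : IsTwisted j (ρ r) (ρ r) x F := isTwisted_groupFourier hx V ρ ha r
    have hfix : r ∈ fixSet act q := by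
      have := act_eq_of_isTwisted V ρ hdist act htwist hF
      rwa [hx] at this
    have hregr : IsTwistRegular hx V ρ r := ⟨F, hF, fun y A hA v => by
      have := groupFourier_conjTranslate j hx V ρ y A.toLinearMap hA a v
      rwa [ha y] at this⟩
    let O : RegOrbit := ⟨Quotient.mk _ ⟨r, hfix⟩, ⟨r, hfix⟩, rfl, hregr⟩
    obtain ⟨u, hu, hur⟩ := Quotient.exact (hrep O).symm
    obtain ⟨y, rfl⟩ := hj u
    obtain ⟨A, hA⟩ : ∃ A : V r ≃ₗ[ℂ] V (rep O).1, IsTwisted j (ρ r) (ρ (rep O).1) y A := by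
      rw [← hur]; exact htwist y r
    obtain ⟨t, ht⟩ := (hS O).exists_smul (isTwisted_groupFourier hx V ρ ha (rep O).1) (hirr _)
    have ht' : groupFourier V ρ (rep O).1 a = t • (S O : Module.End ℂ (V (rep O).1)) :=
      LinearMap.ext ht
    have ht0 : t = 0 := by
      have : φ O (groupFourier V ρ (rep O).1 a) = 0 := congrFun hev O
      rwa [ht', map_smul, hφ, smul_eq_mul, mul_one] at this
    refine hne (LinearMap.ext fun v => ?_)
    have h := groupFourier_conjTranslate j hx V ρ ⟨y, hu⟩ A.toLinearMap hA a v
    rw [ha, ht', ht0, zero_smul, LinearMap.zero_apply, eq_comm, LinearEquiv.coe_coe,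
      LinearEquiv.map_eq_zero_iff] at h
    exact ((ρ r).apply_bijective _).1 (h.trans (map_zero _).symm)
  have hsurj : Function.Surjective ev := by
    choose a ha haS ha0 using fun O =>
      exists_twistedClassFunction hx V ρ hirr hdist act hact1 hactmul htwist (S O) (hcomm O)
    intro v
    refine ⟨∑ O, v O • ⟨a O, ha O⟩, funext fun O => ?_⟩
    rw [map_sum, Finset.sum_apply, Finset.sum_eq_single O]
    · change φ O (groupFourier V ρ (rep O).1 (v O • a O)) = v O
      rw [map_smul, map_smul, haS, hφ, smul_eq_mul, mul_one]
    · intro O' _ hne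
      change φ O (groupFourier V ρ (rep O).1 (v O' • a O')) = 0
      rw [map_smul, ha0 O', smul_zero, map_zero]
      intro u hu hur
      have hrel : orbitSetoid act hact1 hactmul _ (fixSet act q) (rep O') (rep O) := ⟨u, hu, hur⟩
      exact hne (Subtype.ext ((hrep O').symm.trans ((Quotient.sound hrel).trans (hrep O))))
    · simp
  rw [(LinearEquiv.ofBijective ev ⟨hinj, hsurj⟩).finrank_eq, Module.finrank_fintype_fun_eq_card,
    Nat.card_eq_fintype_card]

end Count

section Section

variable {H Q : Type} [Group H] [Group Q] {j : H →* Q} {s : Q → H} (hs : ∀ q, j (s q) = q)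
  {Ghat : Type} (V : Ghat → Type) [∀ r, AddCommGroup (V r)] [∀ r, Module ℂ (V r)]
  (ρ : ∀ r, Representation ℂ j.ker (V r)) (act : Q → Ghat → Ghat)
  (hactmul : ∀ (q₁ q₂ : Q) (r : Ghat), act q₂ (act q₁ r) = act (q₁ * q₂) r)
  (T : ∀ (q : Q) (r : Ghat), V r ≃ₗ[ℂ] V (act q r))
  (hT : ∀ (q : Q) (r : Ghat) (g : j.ker) (v : V r),
    T q r (conjRep j (ρ r) (s q) g v) = ρ (act q r) g (T q r v))
  (c : Ghat → Q → Q → ℂ)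
  (hcdef : ∀ (r : Ghat) (q₁ q₂ : Q) (v : V r),
    T q₂ (act q₁ r) (T q₁ r v) =
      c r q₁ q₂ • castHom V (hactmul q₁ q₂ r).symm
        (T (q₁ * q₂) r (ρ r ((tau j s hs q₁ q₂)⁻¹) v)))

include hT in
theorem exists_isTwisted_castHom {u : Q} {r r' : Ghat} (h : act u r = r') :
    ∃ A : V r ≃ₗ[ℂ] V r', IsTwisted j (ρ r) (ρ r') (s u) A ∧
      ∀ v, A v = castHom V h (T u r v) := by
  subst h
  exact ⟨T u r, fun k v => hT u r k v, fun v => rfl⟩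

include hs hT in
theorem exists_isTwisted (y : H) (r : Ghat) :
    ∃ A : V r ≃ₗ[ℂ] V (act (j y) r), IsTwisted j (ρ r) (ρ (act (j y) r)) y A := by
  let g : j.ker := ⟨(s (j y))⁻¹ * y, by rw [MonoidHom.mem_ker, map_mul, map_inv, hs]; group⟩
  refine ⟨(T (j y) r).trans (LinearEquiv.ofBijective _ ((ρ _).apply_bijective g⁻¹)), ?_⟩
  exact IsTwisted.mul_ker (y := s (j y)) g (by simp [g]) (A := (T (j y) r).toLinearMap)
    fun k v => hT _ r k v

include hcdef in
theorem castHom_comp {q₁ q₂ : Q} {r r₁ r₂ : Ghat} (h₁ : act q₁ r = r₁) (h₂ : act q₂ r₁ = r₂)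
    (h₁₂ : act (q₁ * q₂) r = r₂) (v : V r) :
    castHom V h₂ (T q₂ r₁ (castHom V h₁ (T q₁ r v))) =
      c r q₁ q₂ • castHom V h₁₂ (T (q₁ * q₂) r (ρ r (tau j s hs q₁ q₂)⁻¹ v)) := by
  subst h₁ h₂
  exact hcdef r q₁ q₂ v

omit [Group Q] in
theorem castHom_congr {q₁ q₂ : Q} (h : q₁ = q₂) {r r' : Ghat} (h₁ : act q₁ r = r')
    (h₂ : act q₂ r = r') (v : V r) : castHom V h₁ (T q₁ r v) = castHom V h₂ (T q₂ r v) := by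
  subst h; rfl

include hactmul hT hcdef in
theorem isTwistRegular_iff [∀ r, FiniteDimensional ℂ (V r)] (hirr : ∀ r, IsIrredRep (ρ r))
    (hdist : ∀ r r', RepIso (ρ r) (ρ r') → r = r') {q : Q} {r : Ghat} (hr : act q r = r) :
    IsTwistRegular (hs q) V ρ r ↔
      ∀ u ∈ Subgroup.centralizer ({q} : Set Q), act u r = r → c r u q = c r q u := by
  obtain ⟨S, hS, hSv⟩ := exists_isTwisted_castHom V ρ act T hT hr
  have key : ∀ u (hu : u ∈ Subgroup.centralizer ({q} : Set Q)), act u r = r →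
      ∃ A B : V r ≃ₗ[ℂ] V r, IsTwisted j (ρ r) (ρ r) (s u) A ∧ ∀ v,
        S (A v) = c r u q • B v ∧
        A (ρ r (kerCommutator j (hs q) ⟨s u, by rwa [Subgroup.mem_comap, hs]⟩)⁻¹ (S v)) =
          c r q u • B v := by
    intro u hu hur
    have hcomm : u * q = q * u := Subgroup.mem_centralizer_singleton_iff.mp hu
    have huq : act (u * q) r = r := by rw [← hactmul, hur, hr]
    obtain ⟨A, hA, hAv⟩ := exists_isTwisted_castHom V ρ act T hT hur
    obtain ⟨P, -, hPv⟩ := exists_isTwisted_castHom V ρ act T hT huq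
    refine ⟨A, (LinearEquiv.ofBijective _
      ((ρ r).apply_bijective (tau j s hs u q)⁻¹)).trans P, hA, fun v => ⟨?_, ?_⟩⟩
    · rw [hSv, hAv, castHom_comp hs V ρ act hactmul T c hcdef hur hr huq, ← hPv]
      rfl
    · have := hS (kerCommutator j (hs q) ⟨s u, by rwa [Subgroup.mem_comap, hs]⟩)⁻¹ v
      simp only [LinearEquiv.coe_coe] at this
      rw [← this, hSv, hAv, castHom_comp hs V ρ act hactmul T c hcdef hr hur (hcomm ▸ huq),
        castHom_congr V act T hcomm.symm _ huq, ← hPv, ← Module.End.mul_apply, ← map_mul]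
      change _ • P (ρ r _ v) = _ • P (ρ r _ v)
      congr 4
      ext
      simp only [tau, kerCommutator, MulAut.conjNormal_apply, Subgroup.coe_mul,
        InvMemClass.coe_inv, hcomm]
      group
  constructor
  · rintro ⟨S', hS', hcomm⟩ u hu hur
    obtain ⟨A, B, hA, hAB⟩ := key u hu hur
    obtain ⟨t, ht⟩ := hS'.exists_smul hS (hirr r)
    have := (hirr r).1
    obtain ⟨v, hv⟩ := exists_ne (0 : V r)
    have hSA : S (A v) =
        A (ρ r (kerCommutator j (hs q) ⟨s u, by rwa [Subgroup.mem_comap, hs]⟩)⁻¹ (S v)) := by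
      simp only [LinearEquiv.coe_coe] at ht
      rw [ht, ht, hcomm ⟨s u, by rwa [Subgroup.mem_comap, hs]⟩ A hA, map_smul, map_smul]
    rw [(hAB v).1, (hAB v).2] at hSA
    exact smul_left_injective ℂ (B.map_ne_zero_iff.mpr hv) hSA
  · refine fun hreg => ⟨S, hS, fun y A hA v => ?_⟩
    have hy : act (j y) r = r :=
      act_eq_of_isTwisted V ρ hdist act (exists_isTwisted hs V ρ act T hT) hA
    obtain ⟨A', B, hA', hAB⟩ := key (j y) y.2 hy
    let g : j.ker := ⟨(s (j y))⁻¹ * y, by rw [MonoidHom.mem_ker, map_mul, map_inv, hs]; group⟩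
    have hg : (y : H) = s (j y) * g := by simp [g]
    have hcomm := IsTwisted.comm_mul_ker (hs q) hS (y := ⟨s (j y), by
      rw [Subgroup.mem_comap, hs]; exact y.2⟩) g hg hA' fun w => by
        simp only [LinearEquiv.coe_coe]
        rw [(hAB w).1, (hAB w).2, hreg _ y.2 hy]
    obtain ⟨t, ht⟩ := IsTwisted.exists_smul
      (A := A'.trans (LinearEquiv.ofBijective _ ((ρ r).apply_bijective g⁻¹)))
      (IsTwisted.mul_ker g hg hA') hA (hirr r)
    have ht' : ∀ w, A w = t • ρ r g⁻¹ (A' w) := ht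
    rw [ht', ht', map_smul]
    exact congrArg (t • ·) (hcomm v)

end Section

/-- Fix `q ∈ Q` with conjugacy class `⟨q⟩` and centralizer `C_Q(q)`, and
let `Ĝ^q` be the fixed set of `q` in `Ĝ`, on which `C_Q(q)` acts.  A `C_Q(q)`-orbit
`O ⊆ Ĝ^q` is `c`-regular if some `[ρ] ∈ O` satisfies `c^{[ρ]}(q₁,q) = c^{[ρ]}(q,q₁)` for all
`q₁` in the stabilizer of `[ρ]` in `C_Q(q)`.  Then the number of conjugacy classes of `H`
contained in `j⁻¹(⟨q⟩)` equals the number of `c`-regular `C_Q(q)`-orbits in `Ĝ^q`. -/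
theorem stmt14 {H Q : Type} [Group H] [Group Q] [Fintype H] [Fintype Q]
    (j : H →* Q) (hj : Function.Surjective j)
    (s : Q → H) (hs : ∀ q, j (s q) = q) (hs1 : s 1 = 1)
    {Ghat : Type} [Fintype Ghat]
    (V : Ghat → Type) [∀ r, AddCommGroup (V r)] [∀ r, Module ℂ (V r)]
    [∀ r, FiniteDimensional ℂ (V r)]
    (ρ : ∀ r, Representation ℂ j.ker (V r))
    (hirr : ∀ r, IsIrredRep (ρ r))
    (hdist : ∀ r r', RepIso (ρ r) (ρ r') → r = r')
    (hcomplete : ∀ (W : Type) [AddCommGroup W] [Module ℂ W] [FiniteDimensional ℂ W]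
      (σ : Representation ℂ j.ker W), IsIrredRep σ → ∃ r, RepIso σ (ρ r))
    (act : Q → Ghat → Ghat)
    (hact : ∀ q r, RepIso (conjRep j (ρ r) (s q)) (ρ (act q r)))
    (hact1 : ∀ r, act 1 r = r)
    (hactmul : ∀ (q₁ q₂ : Q) (r : Ghat), act q₂ (act q₁ r) = act (q₁ * q₂) r)
    (T : ∀ (q : Q) (r : Ghat), V r ≃ₗ[ℂ] V (act q r))
    (hT : ∀ (q : Q) (r : Ghat) (g : j.ker) (v : V r),
      T q r (conjRep j (ρ r) (s q) g v) = ρ (act q r) g (T q r v))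
    (hT1 : ∀ (r : Ghat) (v : V r), T 1 r v = castHom V (hact1 r).symm v)
    (c : Ghat → Q → Q → ℂ)
    (hcdef : ∀ (r : Ghat) (q₁ q₂ : Q) (v : V r),
      T q₂ (act q₁ r) (T q₁ r v) =
        c r q₁ q₂ • castHom V (hactmul q₁ q₂ r).symm
          (T (q₁ * q₂) r (ρ r ((tau j s hs q₁ q₂)⁻¹) v)))
    (q : Q) :
    Nat.card {γ : ConjClasses H // ∃ h : H, γ = ConjClasses.mk h ∧ IsConj q (j h)} =
      Nat.card {x : Quotient (orbitSetoid act hact1 hactmul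
            (Subgroup.centralizer ({q} : Set Q)) (fixSet act q)) //
          ∃ r : fixSet act q,
            Quotient.mk (orbitSetoid act hact1 hactmul
                (Subgroup.centralizer ({q} : Set Q)) (fixSet act q)) r = x ∧
            ∀ q₁ ∈ Subgroup.centralizer ({q} : Set Q),
              act q₁ r.1 = r.1 → c r.1 q₁ q = c r.1 q q₁} := by
  rw [← finrank_twistedClassFunctions j (hs q) hj,
    finrank_twistedClassFunctions_eq_card_orbits (hs q) V ρ hirr hdist act hact1 hactmul
      (exists_isTwisted hs V ρ act T hT) hj hcomplete]
  refine Nat.card_congr (Equiv.subtypeEquivRight fun O => exists_congr fun r =>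
    and_congr_right fun _ => ?_)
  exact isTwistRegular_iff hs V ρ act hactmul T hT c hcdef hirr hdist r.2
end
end
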